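/- Let f(x) = (77x³ + 10989x² + 129816x + 496368)³·(77x² + 2376x + 15472) − t·(11x² − 1296)⁴·(11x² + 143x + 621), a polynomial of degree 11 in x with coefficients in ℚ(t). Then the Galois group of (the splitting field of) f over ℚ(t) is a simple group of cardinality 7920 (i.e., it is isomorphic to the Mathieu group M₁₁). -/

import Mathlib

open Polynomial

/-- The generator `t` of the rational function field `ℚ(t)`. -/
noncomputable def t : RatFunc ℚ := RatFunc.X

/-- `f(x) = (77x³ + 10989x² + 129816x + 496368)³ (77x² + 2376x + 15472)
  − t (11x² − 1296)⁴ (11x² + 143x + 621)` over `ℚ(t)`. -/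
noncomputable def f : Polynomial (RatFunc ℚ) :=
  (77 * X ^ 3 + 10989 * X ^ 2 + 129816 * X + 496368) ^ 3 *
      (77 * X ^ 2 + 2376 * X + 15472) -
    C t * ((11 * X ^ 2 - 1296) ^ 4 * (11 * X ^ 2 + 143 * X + 621))

namespace M11
open Finset
open scoped Classical

structure Conf (G R Y : Type) [Group G] [MulAction G R] [MulAction G Y] [Fintype R] [Fintype Y]
    (E : R → Y → Y → Prop) : Prop where
  cR : Fintype.card R = 11
  cY : Fintype.card Y = 12
  faith : ∀ σ : G, (∀ r : R, σ • r = r) → (∀ y : Y, σ • y = y) → σ = 1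
  refl : ∀ r y, E r y y
  symm : ∀ r y z, E r y z → E r z y
  trans : ∀ r x y z, E r x y → E r y z → E r x z
  two : ∀ r x y z, ¬ E r x y → ¬ E r y z → E r x z
  six : ∀ r y, #{z | E r y z} = 6
  equiv : ∀ (σ : G) r y z, E r y z → E (σ • r) (σ • y) (σ • z)
  e11 : ∃ s : G, s ^ 11 = 1 ∧ (∃ y : Y, s • y = y) ∧ (∃ y : Y, s • y ≠ y) ∧ ∀ r : R, s • r ≠ r
  e3 : ∃ s : G, s ^ 3 = 1 ∧ s ≠ 1 ∧ (∃ y : Y, s • y = y) ∧ (∃ r : R, s • r = r)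
  e5 : ∃ s : G, s ^ 5 = 1 ∧ s ≠ 1 ∧ (∃ y : Y, s • y = y) ∧ (∃ r : R, s • r = r)
  ed : ∃ s : G, ∀ y : Y, s • y ≠ y

lemma inj11 {G X : Type} [Group G] [MulAction G X] (s : G) (h : s ^ 11 = 1) (a : X)
    (ha : s • a ≠ a) : Function.Injective (fun i : Fin 11 => s ^ (i : ℕ) • a) := by
  have hp : MulAction.period s a = 11 := by
    have h1 : MulAction.period s a ∣ 11 := by
      rw [← MulAction.pow_smul_eq_iff_period_dvd, h, one_smul]
    rcases (Nat.dvd_prime (by norm_num)).1 h1 with h2 | h2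
    · exfalso
      have : s ^ 1 • a = a := by rw [MulAction.pow_smul_eq_iff_period_dvd, h2]
      exact ha (by simpa using this)
    · exact h2
  have key : ∀ i j : ℕ, i < j → j < 11 → s ^ i • a ≠ s ^ j • a := by
    intro i j hij hj he
    have : s ^ (j - i) • a = a := by
      have : s ^ j = s ^ i * s ^ (j - i) := by rw [← pow_add]; congr 1; omega
      rw [this, mul_smul] at he
      exact (smul_left_cancel _ he).symm
    rw [MulAction.pow_smul_eq_iff_period_dvd, hp] at this
    have := Nat.le_of_dvd (by omega) this
    omega
  intro i j hij
  rcases lt_trichotomy (i : ℕ) j with h | h | h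
  · exact absurd hij (key _ _ h j.2)
  · exact Fin.ext h
  · exact absurd hij.symm (key _ _ h i.2)

section
variable {G R Y : Type} [Group G] [MulAction G R] [MulAction G Y] [Fintype R] [Fintype Y]
    {E : R → Y → Y → Prop} (c : Conf G R Y E)
include c

lemma Conf.equiv' (σ : G) (r y z) : E (σ • r) (σ • y) (σ • z) ↔ E r y z := by
  refine ⟨fun h => ?_, c.equiv σ r y z⟩
  simpa using c.equiv σ⁻¹ _ _ _ h

/-- distinguished data -/
lemma Conf.data : ∃ (s : G) (y₀ : Y), s ^ 11 = 1 ∧ s • y₀ = y₀ ∧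
    (∀ a b : R, ∃ i : ℕ, s ^ i • a = b) ∧
    (∀ a b : Y, a ≠ y₀ → b ≠ y₀ → ∃ i : ℕ, s ^ i • a = b) := by
  obtain ⟨s, h, ⟨y₀, hy⟩, ⟨y₁, hy₁⟩, hr⟩ := c.e11
  refine ⟨s, y₀, h, hy, ?_, ?_⟩
  · intro a b
    have := (Fintype.bijective_iff_injective_and_card _).2
      ⟨inj11 s h a (hr a), by rw [c.cR]; simp⟩
    obtain ⟨i, hi⟩ := this.2 b
    exact ⟨i, hi⟩
  · have hfix : ∀ i : ℕ, s ^ i • y₀ = y₀ := by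
      intro i; induction i with
      | zero => simp
      | succ n ih => rw [pow_succ, mul_smul, hy, ih]
    have h1 : ∀ b, b ≠ y₀ → ∃ i : ℕ, s ^ i • y₁ = b := by
      have hinj := inj11 s h y₁ hy₁
      have hne : ∀ i : ℕ, s ^ i • y₁ ≠ y₀ := by
        intro i hi
        rw [← hfix i] at hi
        have := smul_left_cancel _ hi
        exact hy₁ (this ▸ hy)
      have himg : (univ.image (fun i : Fin 11 => s ^ (i : ℕ) • y₁)) = univ.erase y₀ := by
        apply Finset.eq_of_subset_of_card_le
        · intro z hz
          simp only [mem_image, mem_univ, true_and] at hz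
          obtain ⟨i, rfl⟩ := hz
          simp [hne]
        · rw [Finset.card_image_of_injective _ hinj, card_erase_of_mem (mem_univ _)]
          simp [c.cY]
      intro b hb
      have : b ∈ univ.erase y₀ := by simp [hb]
      rw [← himg] at this
      simp only [mem_image, mem_univ, true_and] at this
      obtain ⟨i, hi⟩ := this
      exact ⟨i, hi⟩
    intro a b ha hb
    obtain ⟨i, rfl⟩ := h1 a ha
    obtain ⟨j, rfl⟩ := h1 b hb
    refine ⟨10 * i + j, ?_⟩
    rw [← mul_smul, ← pow_add, show 10 * i + j + i = 11 * i + j by ring, pow_add, pow_mul, h]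
    simp

lemma Conf.transY (a b : Y) : ∃ g : G, g • a = b := by
  obtain ⟨s, y₀, h, hy, -, hY⟩ := c.data
  obtain ⟨d, hd⟩ := c.ed
  have : ∀ a : Y, ∃ g : G, g • a = y₀ := by
    intro a
    by_cases ha : a = y₀
    · exact ⟨1, by simp [ha]⟩
    · obtain ⟨i, hi⟩ := hY a (d⁻¹ • y₀) ha (fun e => hd y₀ (by rw [inv_smul_eq_iff] at e; exact e.symm))
      exact ⟨d * s ^ i, by rw [mul_smul, hi]; simp⟩
  obtain ⟨g, hg⟩ := this a
  obtain ⟨k, hk⟩ := this b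
  exact ⟨k⁻¹ * g, by rw [mul_smul, hg, ← hk]; simp⟩

lemma Conf.trans2 (a b b' : Y) (hb : b ≠ a) (hb' : b' ≠ a) : ∃ g : G, g • a = a ∧ g • b = b' := by
  obtain ⟨s, y₀, h, hy, -, hY⟩ := c.data
  have hfix : ∀ i : ℕ, s ^ i • y₀ = y₀ := by
      intro i; induction i with
      | zero => simp
      | succ n ih => rw [pow_succ, mul_smul, hy, ih]
  obtain ⟨k, rfl⟩ := c.transY y₀ a
  obtain ⟨i, hi⟩ := hY (k⁻¹ • b) (k⁻¹ • b') (fun e => hb (by rw [← e]; simp))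
    (fun e => hb' (by rw [← e]; simp))
  refine ⟨k * s ^ i * k⁻¹, ?_, ?_⟩
  · simp [mul_smul, hfix]
  · rw [mul_smul, mul_smul, hi]; simp

lemma Conf.transYR (a b : Y) (r q : R) : ∃ g : G, g • a = b ∧ g • r = q := by
  obtain ⟨s, y₀, h, hy, hR, hY⟩ := c.data
  have hfix : ∀ i : ℕ, s ^ i • y₀ = y₀ := by
      intro i; induction i with
      | zero => simp
      | succ n ih => rw [pow_succ, mul_smul, hy, ih]
  obtain ⟨k, hk⟩ := c.transY a y₀
  obtain ⟨l, hl⟩ := c.transY y₀ b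
  obtain ⟨i, hi⟩ := hR (k • r) (l⁻¹ • q)
  exact ⟨l * s ^ i * k, by rw [mul_smul, mul_smul, hk, hfix, hl], by
    rw [mul_smul, mul_smul, hi]; simp⟩

lemma Conf.count5 (y z : Y) (hyz : z ≠ y) : #{r | E r y z} = 5 := by
  have hconst : ∀ w, w ≠ y → #{r | E r y w} = #{r | E r y z} := by
    intro w hw
    obtain ⟨g, h1, h2⟩ := c.trans2 y w z hw hyz
    refine Finset.card_bij (fun r _ => g • r) ?_ ?_ ?_
    · intro r hr
      simp only [mem_filter, mem_univ, true_and] at hr ⊢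
      have := c.equiv g _ _ _ hr
      rwa [h1, h2] at this
    · intro r _ r' _ e
      exact smul_left_cancel _ e
    · intro r hr
      simp only [mem_filter, mem_univ, true_and] at hr
      refine ⟨g⁻¹ • r, ?_, by simp⟩
      simp only [mem_filter, mem_univ, true_and]
      rw [← c.equiv' g, h1, h2]; simpa using hr
  have h1 : ∑ w ∈ univ.erase y, #{r | E r y w} = 11 * #{r | E r y z} := by
    rw [Finset.sum_congr rfl (fun w hw => hconst w (by simpa using hw))]
    simp [card_erase_of_mem, c.cY]
  have h2 : ∑ w ∈ univ.erase y, #{r | E r y w} = ∑ r : R, #{w ∈ univ.erase y | E r y w} := by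
    simp only [card_filter]
    rw [sum_comm]
  have h3 : ∀ r : R, #{w ∈ univ.erase y | E r y w} = 5 := by
    intro r
    have : ({w ∈ univ.erase y | E r y w} : Finset Y) = ({w | E r y w} : Finset Y).erase y := by
      ext w; simp
    rw [this, card_erase_of_mem (by simp [c.refl]), c.six]
  rw [h2, sum_congr rfl (fun r _ => h3 r)] at h1
  simp [c.cR] at h1
  omega

lemma Conf.count2 (y p q : Y) (hp : p ≠ y) (hq : q ≠ y) (hpq : q ≠ p) :
    #{r | E r y p ∧ E r y q} = 2 := by
  have h1 := c.count5 y p hp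
  have h2 := c.count5 y q hq
  have h3 := c.count5 p q hpq
  have h : ∀ r : R, (if E r y p then 1 else 0) + (if E r y q then 1 else 0)
      + (if E r p q then 1 else 0) = 1 + 2 * (if E r y p ∧ E r y q then 1 else 0) := by
    intro r
    have a1 := c.trans r y p q
    have a2 := c.trans r p y q
    have a3 := c.trans r y q p
    have a4 := c.symm r y p
    have a5 := c.symm r p q
    have a6 := c.two r p y q
    have a7 := c.symm r p y
    by_cases x1 : E r y p <;> by_cases x2 : E r y q <;> by_cases x3 : E r p q <;> simp_all
  have := Finset.sum_congr (rfl : (univ : Finset R) = univ) (fun r _ => h r)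
  rw [sum_add_distrib, sum_add_distrib, sum_add_distrib, ← mul_sum] at this
  simp only [← card_filter, h1, h2, h3] at this
  simp [c.cR] at this
  omega

end
end M11

namespace M11
open Finset
open scoped Classical
section
variable {G R Y : Type} [Group G] [MulAction G R] [MulAction G Y] [Fintype R] [Fintype Y]
    {E : R → Y → Y → Prop} (c : Conf G R Y E)
include c

lemma Conf.five (r : R) (y : Y) : #{p | p ≠ y ∧ E r y p} = 5 := by
  have : ({p | p ≠ y ∧ E r y p} : Finset Y) = ({w | E r y w} : Finset Y).erase y := by
    ext w; simp
  rw [this, card_erase_of_mem (by simp [c.refl]), c.six]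

lemma Conf.countA (y : Y) (r r' : R) (hr : r' ≠ r) :
    #{p | p ≠ y ∧ E r y p ∧ E r' y p} = 2 := by
  set B : Finset Y := {p | p ≠ y ∧ E r y p} with hB
  have hB5 : #B = 5 := c.five r y
  let a : R → ℕ := fun s => #{p ∈ B | E s y p}
  have ha : ∀ s, (a s : ℤ) = ∑ p ∈ B, if E s y p then 1 else 0 := by
    intro s; simp [a]
  have hBm : ∀ p ∈ B, p ≠ y ∧ E r y p := by intro p hp; simpa [hB] using hp
  have h1 : ∑ s ∈ univ.erase r, (a s : ℤ) = 20 := by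
    simp only [ha]
    rw [sum_comm]
    have : ∀ p ∈ B, ∑ s ∈ univ.erase r, (if E s y p then (1 : ℤ) else 0) = 4 := by
      intro p hp
      obtain ⟨h1, h2⟩ := hBm p hp
      have h5 := c.count5 y p h1
      have : #{s ∈ univ.erase r | E s y p} = 4 := by
        have e : ({s ∈ univ.erase r | E s y p} : Finset R) = ({s | E s y p} : Finset R).erase r := by
          ext w; simp
        rw [e, card_erase_of_mem (by simp [h2]), h5]
      rw [← Finset.sum_filter]
      simp [this]
    rw [sum_congr rfl this]; simp [hB5]
  have h2 : ∑ s ∈ univ.erase r, (a s : ℤ) ^ 2 = 40 := by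
    have e : ∀ s, (a s : ℤ) ^ 2 = ∑ p ∈ B, ∑ q ∈ B, if E s y p ∧ E s y q then 1 else 0 := by
      intro s
      rw [ha, sq, sum_mul_sum]
      refine sum_congr rfl fun p _ => sum_congr rfl fun q _ => ?_
      by_cases x : E s y p <;> by_cases z : E s y q <;> simp [x, z]
    simp only [e]
    rw [sum_comm]
    have key : ∀ p ∈ B, ∑ s ∈ univ.erase r, ∑ q ∈ B, (if E s y p ∧ E s y q then (1 : ℤ) else 0) = 8 := by
      intro p hp
      rw [sum_comm, ← Finset.add_sum_erase _ _ hp]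
      obtain ⟨h1, h2⟩ := hBm p hp
      have A1 : ∑ s ∈ univ.erase r, (if E s y p ∧ E s y p then (1 : ℤ) else 0) = 4 := by
        have : #{s ∈ univ.erase r | E s y p} = 4 := by
          have e : ({s ∈ univ.erase r | E s y p} : Finset R) = ({s | E s y p} : Finset R).erase r := by
            ext w; simp
          rw [e, card_erase_of_mem (by simp [h2]), c.count5 y p h1]
        simp only [and_self]
        rw [← Finset.sum_filter]
        simp [this]
      have A2 : ∀ q ∈ B.erase p, ∑ s ∈ univ.erase r, (if E s y p ∧ E s y q then (1 : ℤ) else 0) = 1 := by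
        intro q hq
        rw [mem_erase] at hq
        obtain ⟨h3, h4⟩ := hBm q hq.2
        have : #{s ∈ univ.erase r | E s y p ∧ E s y q} = 1 := by
          have e : ({s ∈ univ.erase r | E s y p ∧ E s y q} : Finset R)
            = ({s | E s y p ∧ E s y q} : Finset R).erase r := by
            ext w; simp
          rw [e, card_erase_of_mem (by simp [h2, h4]), c.count2 y p q h1 h3 hq.1]
        rw [← Finset.sum_filter]
        simp [this]
      rw [A1, sum_congr rfl A2]
      simp [card_erase_of_mem hp, hB5]
    rw [sum_congr rfl key]; simp [hB5]
  have h3 : ∑ s ∈ univ.erase r, ((a s : ℤ) - 2) ^ 2 = 0 := by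
    have : ∀ s : R, ((a s : ℤ) - 2) ^ 2 = (a s : ℤ) ^ 2 - 4 * a s + 4 := fun s => by ring
    simp only [this]
    rw [sum_add_distrib, sum_sub_distrib, ← mul_sum, h1, h2]
    simp [card_erase_of_mem, c.cR]
  rw [Finset.sum_eq_zero_iff_of_nonneg (fun _ _ => sq_nonneg _)] at h3
  have h4 := h3 r' (by simp [hr])
  have h5 : (a r' : ℤ) = 2 := by nlinarith
  have h6 : a r' = 2 := by exact_mod_cast h5
  rw [← h6]
  simp only [a, hB, filter_filter, and_assoc]

/-- if all of R is fixed and one y is fixed then trivial -/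
lemma Conf.rigid1 (σ : G) (y : Y) (hy : σ • y = y) (hR : ∀ r : R, σ • r = r) : σ = 1 := by
  refine c.faith σ hR fun z => ?_
  by_contra hz
  have hzy : z ≠ y := fun e => hz (by rw [e, hy])
  have hzy' : σ • z ≠ y := fun e => hzy (by
    have := e.trans hy.symm
    exact smul_left_cancel _ this)
  have h2 := c.count2 y z (σ • z) hzy hzy' hz
  have h5 := c.count5 y z hzy
  have : ∀ r, (E r y z ∧ E r y (σ • z)) ↔ E r y z := by
    intro r
    refine ⟨fun h => h.1, fun h => ⟨h, ?_⟩⟩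
    have := c.equiv σ _ _ _ h
    rwa [hR, hy] at this
  simp only [this] at h2
  omega

lemma Conf.pair (y : Y) (r r' : R) (hr : r' ≠ r) : ∃ p q, p ≠ q ∧
    (p ≠ y ∧ E r y p ∧ E r' y p) ∧ (q ≠ y ∧ E r y q ∧ E r' y q) ∧
    ∀ z, z ≠ y → E r y z → E r' y z → z = p ∨ z = q := by
  obtain ⟨p, q, h1, h2⟩ := card_eq_two.1 (c.countA y r r' hr)
  have : ∀ z, (z ≠ y ∧ E r y z ∧ E r' y z) ↔ z = p ∨ z = q := by
    intro z
    have := congrArg (z ∈ ·) h2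
    simpa using this
  exact ⟨p, q, h1, (this p).2 (Or.inl rfl), (this q).2 (Or.inr rfl), fun z a b d =>
    (this z).1 ⟨a, b, d⟩⟩

/-- rows containing two common points of row r -/
lemma Conf.row_unique (y : Y) (r r' s p q) (hp : p ≠ y) (hq : q ≠ y) (hpq : p ≠ q)
    (hr' : r' ≠ r) (hs : s ≠ r) (h1 : E r y p) (h2 : E r y q) (h3 : E r' y p) (h4 : E r' y q)
    (h5 : E s y p) (h6 : E s y q) : s = r' := by
  by_contra hne
  have h := c.count2 y p q hp hq hpq.symm
  have : ({r, r', s} : Finset R) ⊆ ({r | E r y p ∧ E r y q} : Finset R) := by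
    intro x hx
    simp only [mem_insert, mem_singleton] at hx
    rcases hx with rfl | rfl | rfl <;> simp [*]
  have h7 := card_le_card this
  rw [h, card_eq_three.2 ⟨r, r', s, hr'.symm, hs.symm, fun e => hne e.symm, rfl⟩] at h7
  omega

lemma Conf.rigid2 (σ : G) (y : Y) (r : R) (hy : σ • y = y) (hr : σ • r = r)
    (h : ∀ p, E r y p → σ • p = p) : σ = 1 := by
  refine c.rigid1 σ y hy fun r' => ?_
  by_cases hrr : r' = r
  · rw [hrr, hr]
  obtain ⟨p, q, hpq, ⟨p1, p2, p3⟩, ⟨q1, q2, q3⟩, -⟩ := c.pair y r r' hrr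
  refine c.row_unique y r r' (σ • r') p q p1 q1 hpq hrr ?_ p2 q2 p3 q3 ?_ ?_
  · intro e; exact hrr (smul_left_cancel σ (e.trans hr.symm))
  · have := c.equiv σ _ _ _ p3
    rwa [hy, h p p2] at this
  · have := c.equiv σ _ _ _ q3
    rwa [hy, h q q2] at this

/-- no swap -/
lemma Conf.noswap (τ : G) (y : Y) (r : R) (hy : τ • y = y) (hr : τ • r = r) (p₁ p₂ : Y)
    (hp : p₁ ≠ p₂) (h1 : p₁ ≠ y) (h2 : p₂ ≠ y) (h3 : E r y p₁) (h4 : E r y p₂)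
    (s1 : τ • p₁ = p₂) (s2 : τ • p₂ = p₁) (s3 : ∀ p, E r y p → p ≠ p₁ → p ≠ p₂ → τ • p = p) :
    False := by
  have hsq : τ * τ = 1 := by
    refine c.rigid2 _ y r (by rw [mul_smul, hy, hy]) (by rw [mul_smul, hr, hr]) fun p hp => ?_
    rw [mul_smul]
    by_cases e1 : p = p₁
    · rw [e1, s1, s2]
    by_cases e2 : p = p₂
    · rw [e2, s2, s1]
    rw [s3 p hp e1 e2, s3 p hp e1 e2]
  have hinvR : ∀ x : R, τ • τ • x = x := fun x => by rw [← mul_smul, hsq, one_smul]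
  have hinvY : ∀ x : Y, τ • τ • x = x := fun x => by rw [← mul_smul, hsq, one_smul]
  have hfix : ∀ r', r' ≠ r → (τ • r' = r' ↔ (E r' y p₁ ↔ E r' y p₂)) := by
    intro r' hr'
    constructor
    · intro e
      constructor
      · intro h
        have := c.equiv τ _ _ _ h
        rwa [e, hy, s1] at this
      · intro h
        have := c.equiv τ _ _ _ h
        rwa [e, hy, s2] at this
    · intro e
      obtain ⟨p, q, hpq, ⟨a1, a2, a3⟩, ⟨b1, b2, b3⟩, hu⟩ := c.pair y r r' hr'
      have key : ∀ z, z ≠ y → E r y z → E r' y z → E (τ • r') y z := by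
        intro z hz1 hz2 hz3
        by_cases e1 : z = p₁
        · subst e1
          have := c.equiv τ _ _ _ (e.1 hz3)
          rwa [hy, s2] at this
        by_cases e2 : z = p₂
        · subst e2
          have := c.equiv τ _ _ _ (e.2 hz3)
          rwa [hy, s1] at this
        have := c.equiv τ _ _ _ hz3
        rwa [hy, s3 z hz2 e1 e2] at this
      exact c.row_unique y r r' (τ • r') p q a1 b1 hpq hr'
        (fun e => hr' (smul_left_cancel τ (e.trans hr.symm))) a2 b2 a3 b3 (key p a1 a2 a3)
        (key q b1 b2 b3)
  have hq : ∀ q, ¬ E r y q → τ • q = q := by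
    intro q hq
    by_contra hne
    have hqy : q ≠ y := fun e => hq (by rw [e]; exact c.refl _ _)
    have hqy' : τ • q ≠ y := fun e => hqy (smul_left_cancel τ (e.trans hy.symm))
    have hqp1 : q ≠ p₁ := fun e => hq (by rw [e]; exact h3)
    have hqp2 : q ≠ p₂ := fun e => hq (by rw [e]; exact h4)
    set S : Finset R := {s | E s y q ∧ E s y (τ • q)} with hS
    have hS2 : #S = 2 := c.count2 y q (τ • q) hqy hqy' hne
    have inv1 : ∑ s ∈ S, (if τ • s = s then (0 : ZMod 2) else 1) = 0 := by
      refine Finset.sum_involution (fun s _ => τ • s) ?_ ?_ ?_ ?_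
      · intro s hs
        rw [hinvR]
        by_cases e : τ • s = s
        · simp [e]
        · have e' : ¬ s = τ • s := fun x => e x.symm
          simp [e, e']; decide
      · intro s hs h e
        simp [e] at h
      · intro s hs
        simp only [hS, mem_filter, mem_univ, true_and] at hs ⊢
        have x1 := c.equiv τ _ _ _ hs.1
        have x2 := c.equiv τ _ _ _ hs.2
        rw [hy] at x1 x2
        rw [hinvY] at x2
        exact ⟨x2, x1⟩
      · intro s hs
        exact hinvR s
    -- fixed points in E_q
    have hcount : #{s | E s y q ∧ τ • s = s} % 2 = 1 := by
      have c1 := c.count2 y q p₁ hqy h1 hqp1.symm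
      have c2 := c.count2 y q p₂ hqy h2 hqp2.symm
      have c0 := c.count5 y q hqy
      have hpt : ∀ s : R, (if E s y q ∧ τ • s = s then 1 else 0) +
          (if E s y q ∧ E s y p₁ then 1 else 0) + (if E s y q ∧ E s y p₂ then 1 else 0) =
          (if E s y q then 1 else 0) + 2 * (if E s y q ∧ E s y p₁ ∧ E s y p₂ then 1 else 0) := by
        intro s
        by_cases a : E s y q
        · have hsr : s ≠ r := fun e => hq (e ▸ a)
          have := hfix s hsr
          rw [this]
          by_cases b : E s y p₁ <;> by_cases d : E s y p₂ <;> simp [a, b, d]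
        · simp [a]
      have := Finset.sum_congr (rfl : (univ : Finset R) = univ) (fun r _ => hpt r)
      rw [sum_add_distrib, sum_add_distrib, sum_add_distrib, ← mul_sum] at this
      simp only [← card_filter, c1, c2, c0] at this
      omega
    have hsub : ({s ∈ S | τ • s = s} : Finset R) = ({s | E s y q ∧ τ • s = s} : Finset R) := by
      ext s
      simp only [hS, mem_filter, mem_univ, true_and]
      constructor
      · rintro ⟨⟨a, _⟩, b⟩; exact ⟨a, b⟩
      · rintro ⟨a, b⟩
        refine ⟨⟨a, ?_⟩, b⟩
        have := c.equiv τ _ _ _ a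
        rwa [b, hy] at this
    have h7 := Finset.card_filter_add_card_filter_not (s := S) (fun s => τ • s = s)
    have h8 : ((#{s ∈ S | ¬ τ • s = s} : ℕ) : ZMod 2) = 0 := by
      rw [← inv1, ← Finset.sum_boole]
      refine sum_congr rfl fun s _ => ?_
      by_cases e : τ • s = s <;> simp [e]
    rw [ZMod.natCast_eq_zero_iff] at h8
    rw [hsub, hS2] at h7
    omega
  -- pick q
  have hex : ∃ q, ¬ E r y q := by
    by_contra hcon
    push Not at hcon
    have := c.six r y
    simp [hcon, c.cY] at this
  obtain ⟨q, hq0⟩ := hex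
  have := c.rigid2 τ q r (hq q hq0) hr (fun p hp => hq p fun e => hq0 (c.trans r y p q e (c.symm r q p hp)))
  rw [this, one_smul] at s1
  exact hp s1

lemma Conf.faithR (σ : G) (hR : ∀ r : R, σ • r = r) : σ = 1 := by
  by_contra hne
  let K : Subgroup G := (MulAction.toPermHom G R).ker
  have hK : ∀ k : G, k ∈ K ↔ ∀ r : R, k • r = r := by
    intro k
    simp only [K, MonoidHom.mem_ker, Equiv.Perm.ext_iff]
    rfl
  have hnofix : ∀ k ∈ K, ∀ y : Y, k • y = y → k = 1 := fun k hk y h => c.rigid1 k y h ((hK k).1 hk)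
  have hsq : ∀ k ∈ K, k * k = 1 := by
    intro k hk
    obtain ⟨s, y, -⟩ := c.data
    refine hnofix _ (mul_mem hk hk) y ?_
    by_contra hy
    have h5 := c.count5 y ((k * k) • y) hy
    have : ∀ r, E r y ((k * k) • y) := by
      intro r
      have hkr := (hK k).1 hk r
      by_cases h : E r y (k • y)
      · have := c.equiv k _ _ _ h
        rw [hkr] at this
        rw [mul_smul]
        exact c.trans _ _ _ _ h this
      · refine c.two r y (k • y) _ h ?_
        rw [mul_smul]
        intro h'
        rw [← c.equiv' k, hkr] at h
        exact h h'
    simp [this, c.cR] at h5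
  obtain ⟨s, y, -⟩ := c.data
  have hbij : Function.Bijective (fun k : K => (k : G) • y) := by
    constructor
    · intro k l e
      have : ((l : G)⁻¹ * k) • y = y := by
        rw [mul_smul]; simp only at e; rw [e]; simp
      have := hnofix _ (mul_mem (inv_mem l.2) k.2) y this
      exact Subtype.ext (inv_mul_eq_one.1 this).symm
    · intro z
      by_cases hz : z = y
      · exact ⟨1, by simp [hz]⟩
      have hσ : σ • y ≠ y := fun e => hne (hnofix σ ((hK σ).2 hR) y e)
      obtain ⟨g, g1, g2⟩ := c.trans2 y (σ • y) z hσ hz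
      have : g * σ * g⁻¹ ∈ K := (inferInstance : K.Normal).conj_mem _ ((hK σ).2 hR) g
      refine ⟨⟨_, this⟩, ?_⟩
      have g3 : g⁻¹ • y = y := by rw [inv_smul_eq_iff, g1]
      simp only [mul_smul, g3, g2]
  have hcard : Nat.card K = 12 := by
    rw [Nat.card_congr (Equiv.ofBijective _ hbij), Nat.card_eq_fintype_card, c.cY]
  have : Finite K := Nat.finite_of_card_ne_zero (by omega)
  obtain ⟨k, hk⟩ := exists_prime_orderOf_dvd_card' (G := K) 3 (by rw [hcard]; norm_num)
  have : orderOf k ∣ 2 := orderOf_dvd_of_pow_eq_one (by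
    rw [sq]; exact Subtype.ext (hsq k k.2))
  rw [hk] at this
  omega
end
end M11

namespace M11
open Finset
open scoped Classical
lemma cube11 : ∀ u : ZMod 11, u * (u * u) = 1 → u = 1 := by decide

section
variable {G R Y : Type} [Group G] [MulAction G R] [MulAction G Y] [Fintype R] [Fintype Y]
    {E : R → Y → Y → Prop} (c : Conf G R Y E)
include c

lemma Conf.fin : Finite G := by
  have : Function.Injective (MulAction.toPermHom G R) := by
    rw [injective_iff_map_eq_one]
    intro σ h
    exact c.faithR σ fun r => by
      have := Equiv.Perm.ext_iff.1 h r
      exact this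
  exact Finite.of_injective _ this

lemma Conf.stab (y : Y) (r : R) : ∃ (A : Subgroup G), (∀ a, a ∈ A ↔ a • y = y ∧ a • r = r) ∧
    Nat.card A = 60 ∧ IsSimpleGroup A ∧ ∃ s ∈ A, s ^ 3 = 1 ∧ s ≠ 1 := by
  let A : Subgroup G := MulAction.stabilizer G y ⊓ MulAction.stabilizer G r
  have hA : ∀ a, a ∈ A ↔ a • y = y ∧ a • r = r := by
    intro a; simp [A, Subgroup.mem_inf]
  let B := {p : Y // p ≠ y ∧ E r y p}
  have hB : Fintype.card B = 5 := by
    rw [Fintype.card_subtype]; exact c.five r y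
  have hpres : ∀ a : A, ∀ p : Y, (p ≠ y ∧ E r y p) ↔
      ((MulAction.toPerm (a : G) : Equiv.Perm Y) p ≠ y ∧ E r y ((MulAction.toPerm (a : G) : Equiv.Perm Y) p)) := by
    intro a p
    obtain ⟨h1, h2⟩ := (hA a).1 a.2
    have e := c.equiv' (a : G) r y p
    rw [h1, h2] at e
    simp only [MulAction.toPerm_apply]
    rw [e]
    refine and_congr_left fun _ => not_congr ⟨fun h => by rw [h, h1], fun h => ?_⟩
    exact smul_left_cancel _ (h.trans h1.symm)
  let φ : A →* Equiv.Perm B :=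
    { toFun := fun a => (MulAction.toPerm (a : G) : Equiv.Perm Y).subtypePerm (fun p => (hpres a p).symm)
      map_one' := by ext p; simp
      map_mul' := by intro a b; ext p; simp [mul_smul] }
  have hφ : ∀ (a : A) (p : B), ((φ a p : B) : Y) = (a : G) • (p : Y) := fun a p => rfl
  have hinj : Function.Injective φ := by
    rw [injective_iff_map_eq_one]
    intro a ha
    obtain ⟨h1, h2⟩ := (hA a).1 a.2
    refine Subtype.ext (c.rigid2 (a : G) y r h1 h2 fun p hp => ?_)
    by_cases e : p = y
    · rw [e, h1]
    have := hφ a ⟨p, e, hp⟩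
    rw [ha] at this
    exact this.symm
  have conj : ∀ n : ℕ, (∃ s : G, s ^ n = 1 ∧ s ≠ 1 ∧ (∃ y : Y, s • y = y) ∧ (∃ r : R, s • r = r)) →
      ∃ s : A, s ^ n = 1 ∧ s ≠ 1 := by
    rintro n ⟨s, h1, h2, ⟨y', hy⟩, ⟨r', hr⟩⟩
    obtain ⟨g, g1, g2⟩ := c.transYR y y' r r'
    have g3 : g⁻¹ • y' = y := by rw [inv_smul_eq_iff, g1]
    have g4 : g⁻¹ • r' = r := by rw [inv_smul_eq_iff, g2]
    refine ⟨⟨g⁻¹ * s * g, (hA _).2 ⟨by rw [mul_smul, mul_smul, g1, hy, g3],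
      by rw [mul_smul, mul_smul, g2, hr, g4]⟩⟩, Subtype.ext ?_, fun e => h2 ?_⟩
    · have := conj_pow (i := n) (a := g⁻¹) (b := s)
      simp only [inv_inv] at this
      simp [this, h1]
    · have := congrArg Subtype.val e
      simp only [Subgroup.coe_one] at this
      have h : s = g * (g⁻¹ * s * g) * g⁻¹ := by group
      rw [h, this]; simp
  obtain ⟨s3, a1, a2⟩ := conj 3 c.e3
  obtain ⟨s5, b1, b2⟩ := conj 5 c.e5
  have ho3 : orderOf (φ s3) = 3 := by
    rw [orderOf_injective φ hinj]; exact orderOf_eq_prime a1 a2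
  have ho5 : orderOf (φ s5) = 5 := by
    have : Fact (Nat.Prime 5) := ⟨by norm_num⟩
    rw [orderOf_injective φ hinj]; exact orderOf_eq_prime b1 b2
  have h3 : (φ s3).IsThreeCycle := by
    obtain ⟨n, hn⟩ := Equiv.Perm.cycleType_prime_order (σ := φ s3) (by rw [ho3]; norm_num)
    have hs := Equiv.Perm.sum_cycleType (φ s3)
    have hle : #(φ s3).support ≤ 5 := by rw [← hB]; exact Finset.card_le_univ _
    rw [hn, ho3] at hs
    simp at hs
    have : n = 0 := by omega
    rw [Equiv.Perm.IsThreeCycle, hn, this, ho3]; rfl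
  have h5 : (φ s5).IsCycle ∧ (φ s5).support = univ := by
    obtain ⟨n, hn⟩ := Equiv.Perm.cycleType_prime_order (σ := φ s5) (by rw [ho5]; norm_num)
    have hs := Equiv.Perm.sum_cycleType (φ s5)
    have hle : #(φ s5).support ≤ 5 := by rw [← hB]; exact Finset.card_le_univ _
    rw [hn, ho5] at hs
    simp at hs
    have : n = 0 := by omega
    subst this
    refine ⟨?_, ?_⟩
    · rw [← Equiv.Perm.card_cycleType_eq_one, hn]; simp
    · rw [← Finset.card_eq_iff_eq_univ, hB]; omega
  have htr : MulAction.IsPretransitive φ.range B := by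
    refine ⟨fun x z => ?_⟩
    have hx : φ s5 x ≠ x := by rw [← Equiv.Perm.mem_support, h5.2]; simp
    have hz : φ s5 z ≠ z := by rw [← Equiv.Perm.mem_support, h5.2]; simp
    obtain ⟨i, hi⟩ := h5.1.sameCycle hx hz
    exact ⟨⟨φ s5 ^ i, ⟨s5 ^ i, by simp⟩⟩, hi⟩
  have hpp : MulAction.IsPreprimitive φ.range B :=
    MulAction.IsPreprimitive.of_prime_card (by rw [Nat.card_eq_fintype_card, hB]; norm_num)
  have hle := Equiv.Perm.alternatingGroup_le_of_isPreprimitive_of_isThreeCycle_mem hpp h3 ⟨s3, rfl⟩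
  have hns : ∀ p q : B, p ≠ q → Equiv.swap p q ∉ φ.range := by
    rintro p q hpq ⟨a, ha⟩
    obtain ⟨h1, h2⟩ := (hA a).1 a.2
    refine c.noswap (a : G) y r h1 h2 p q (fun e => hpq (Subtype.ext e)) p.2.1 q.2.1 p.2.2 q.2.2
      ?_ ?_ ?_
    · rw [← hφ, ha, Equiv.swap_apply_left]
    · rw [← hφ, ha, Equiv.swap_apply_right]
    · intro z hz z1 z2
      by_cases e : z = y
      · rw [e, h1]
      have := hφ a ⟨z, e, hz⟩
      rw [ha, Equiv.swap_apply_of_ne_of_ne (fun e => z1 (congrArg Subtype.val e))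
        (fun e => z2 (congrArg Subtype.val e))] at this
      exact this.symm
  have hnt : Nontrivial B := Fintype.one_lt_card_iff_nontrivial.1 (by omega)
  have heq : φ.range = alternatingGroup B := by
    refine le_antisymm (fun σ hσ => ?_) hle
    by_contra hs
    obtain ⟨p, q, hpq⟩ := exists_pair_ne B
    apply hns p q hpq
    have hs' : Equiv.Perm.sign σ = -1 := by
      rw [Equiv.Perm.mem_alternatingGroup] at hs
      exact (Int.units_eq_one_or _).resolve_left hs
    have : Equiv.swap p q * σ ∈ alternatingGroup B := by
      rw [Equiv.Perm.mem_alternatingGroup, Equiv.Perm.sign_mul, Equiv.Perm.sign_swap hpq, hs']; simp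
    have := mul_mem (hle this) (inv_mem hσ)
    simpa using this
  let e : A ≃* alternatingGroup B := (MonoidHom.ofInjective hinj).trans (MulEquiv.subgroupCongr heq)
  refine ⟨A, hA, ?_, ?_, s3, s3.2, by simpa using congrArg Subtype.val a1,
    fun e => a2 (Subtype.ext e)⟩
  · rw [Nat.card_congr e.toEquiv, nat_card_alternatingGroup, Nat.card_eq_fintype_card, hB]
    rfl
  · have := alternatingGroup.isSimpleGroup (α := B) (by rw [Nat.card_eq_fintype_card, hB])
    exact (MulEquiv.isSimpleGroup_congr e).2 this

lemma Conf.card : Nat.card G = 7920 := by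
  have hf := c.fin
  obtain ⟨s, y, -⟩ := c.data
  obtain ⟨s', -, -, -, r, -⟩ := c.e3
  obtain ⟨A, hA, hc, -⟩ := c.stab y r
  have htr : MulAction.IsPretransitive G (Y × R) := by
    refine ⟨fun a b => ?_⟩
    obtain ⟨g, h1, h2⟩ := c.transYR a.1 b.1 a.2 b.2
    exact ⟨g, Prod.ext h1 h2⟩
  have h : MulAction.stabilizer G (y, r) = A := by
    ext a
    rw [hA, MulAction.mem_stabilizer_iff]
    exact Prod.ext_iff
  have h1 := MulAction.index_stabilizer_of_transitive G ((y, r) : Y × R)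
  have h2 := Subgroup.card_mul_index A
  rw [← h2, hc, ← h, h1]
  simp [c.cR, c.cY]

lemma Conf.faithY (σ : G) (hY : ∀ y : Y, σ • y = y) : σ = 1 := by
  refine c.faithR σ fun r => ?_
  by_contra hr
  obtain ⟨s, y, -⟩ := c.data
  have h := c.countA y r (σ • r) hr
  have h5 := c.five r y
  have : ∀ p, E (σ • r) y p ↔ E r y p := by
    intro p
    have := c.equiv' σ r y p
    rwa [hY, hY] at this
  simp only [this, and_self] at h
  omega

lemma Conf.simple : IsSimpleGroup G := by
  have hf := c.fin
  have hcard := c.card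
  obtain ⟨s, y, -⟩ := c.data
  obtain ⟨s', -, -, -, r, -⟩ := c.e3
  obtain ⟨A, hA, hc, hsimple, s, hsA, hs3, hs1⟩ := c.stab y r
  have hnt : Nontrivial G := Finite.one_lt_card_iff_nontrivial.1 (by omega)
  refine { eq_bot_or_eq_top_of_normal := fun N hN => ?_ }
  by_cases hbot : N = ⊥
  · exact Or.inl hbot
  right
  obtain ⟨n, hnN, hn1⟩ : ∃ n, n ∈ N ∧ n ≠ 1 := by
    obtain ⟨n, h⟩ := Subgroup.ne_bot_iff_exists_ne_one.1 hbot
    exact ⟨n.1, n.2, fun e => h (Subtype.ext e)⟩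
  -- transitive on Y
  have htY : MulAction.IsPretransitive N Y := by
    have : ∃ z : Y, n • z ≠ z := by
      by_contra hcon; push Not at hcon; exact hn1 (c.faithY n hcon)
    obtain ⟨z, hz⟩ := this
    have : ∀ w, ∃ k : N, k • z = w := by
      intro w
      by_cases hw : w = z
      · exact ⟨1, by simp [hw]⟩
      obtain ⟨g, g1, g2⟩ := c.trans2 z (n • z) w hz hw
      have g3 : g⁻¹ • z = z := by rw [inv_smul_eq_iff, g1]
      exact ⟨⟨_, hN.conj_mem n hnN g⟩, by rw [Subgroup.mk_smul, mul_smul, mul_smul, g3, g2]⟩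
    refine ⟨fun a b => ?_⟩
    obtain ⟨k, hk⟩ := this a
    obtain ⟨l, hl⟩ := this b
    exact ⟨l * k⁻¹, by rw [mul_smul, ← hk, inv_smul_smul, hl]⟩
  have htR : MulAction.IsPretransitive N R := by
    have t0 : MulAction.IsPretransitive G R := ⟨fun a b => by
      obtain ⟨g, -, h⟩ := c.transYR y y a b
      exact ⟨g, h⟩⟩
    have : MulAction.IsPreprimitive G R :=
      MulAction.IsPreprimitive.of_prime_card (by rw [Nat.card_eq_fintype_card, c.cR]; norm_num)
    refine MulAction.IsQuasiPreprimitive.isPretransitive_of_normal (G := G) (N := N) ?_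
    intro e
    apply hn1
    refine c.faithR n fun x => ?_
    have : x ∈ MulAction.fixedPoints N R := by rw [e]; trivial
    exact this ⟨n, hnN⟩
  have h12 := MulAction.index_stabilizer_of_transitive N y
  have h11 := MulAction.index_stabilizer_of_transitive N r
  rw [Nat.card_eq_fintype_card, c.cY] at h12
  rw [Nat.card_eq_fintype_card, c.cR] at h11
  have k12 := Subgroup.card_mul_index (MulAction.stabilizer N y)
  have k11 := Subgroup.card_mul_index (MulAction.stabilizer N r)
  rw [h12] at k12
  rw [h11] at k11
  have hdvd : Nat.card N ∣ 7920 := hcard ▸ Subgroup.card_subgroup_dvd_card N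
  set Ny := MulAction.stabilizer N y with hNy
  have d11 : 11 ∣ Nat.card Ny := by
    have : 11 ∣ Nat.card Ny * 12 := ⟨_, by rw [k12, ← k11, mul_comm]⟩
    exact (Nat.Coprime.dvd_mul_right (by norm_num)).1 this
  have : (N.subgroupOf A).Normal := inferInstance
  rcases hsimple.eq_bot_or_eq_top_of_normal _ this with hb | ht
  · exfalso
    have hdis : N ⊓ A = ⊥ := by
      rw [Subgroup.subgroupOf_eq_bot] at hb
      exact hb.eq_bot
    -- card N = 132
    have hle : Nat.card N * 60 ≤ 7920 := by
      rw [← hcard, ← hc, ← Nat.card_prod]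
      refine Nat.card_le_card_of_injective (fun x : N × A => (x.1 : G) * x.2) ?_
      exact Subgroup.mul_injective_of_disjoint (disjoint_iff.2 hdis)
    have hNy11 : Nat.card Ny = 11 := by
      obtain ⟨k, hk⟩ := d11
      have : 0 < Nat.card Ny := Nat.card_pos
      omega
    have : Fact (Nat.Prime 11) := ⟨by norm_num⟩
    obtain ⟨m, hm⟩ := exists_prime_orderOf_dvd_card' (G := Ny) 11 (by rw [hNy11])
    have hgen : ∀ x : Ny, x ∈ Subgroup.zpowers m := by
      intro x
      have : Subgroup.zpowers m = ⊤ := by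
        apply Subgroup.eq_top_of_card_eq
        rw [Nat.card_zpowers, hm, hNy11]
      rw [this]; trivial
    let m' : G := ((m : N) : G)
    have hm' : orderOf m' = 11 := by
      rw [← hm]
      exact (Subgroup.orderOf_coe (m : N)).trans (Subgroup.orderOf_coe m)
    have hmy : m' • y = y := m.2
    have hmN : m' ∈ N := (m : N).2
    have hgen' : ∀ x ∈ N, x • y = y → ∃ k : ℕ, m' ^ k = x := by
      intro x hx hxy
      have := hgen ⟨⟨x, hx⟩, hxy⟩
      rw [← mem_powers_iff_mem_zpowers] at this
      obtain ⟨k, hk⟩ := this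
      exact ⟨k, by simpa [m'] using congrArg (fun z : Ny => ((z : N) : G)) hk⟩
    obtain ⟨hsy, hsr⟩ := (hA s).1 hsA
    have hsy' : s⁻¹ • y = y := by rw [inv_smul_eq_iff, hsy]
    obtain ⟨k, hk⟩ := hgen' (s * m' * s⁻¹) (hN.conj_mem _ hmN s)
      (by rw [mul_smul, mul_smul, hsy', hmy, hsy])
    have hcj : ∀ i : ℕ, s * m' ^ i * s⁻¹ = m' ^ (k * i) := by
      intro i
      rw [pow_mul, hk, conj_pow]
    have hcube : m' ^ (k * (k * k)) = m' ^ 1 := by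
      have e1 : s * (s * (s * m' * s⁻¹) * s⁻¹) * s⁻¹ = m' ^ (k * (k * k)) := by
        rw [← hk, hcj, hcj]
      have e2 : s * (s * (s * m' * s⁻¹) * s⁻¹) * s⁻¹ = s ^ 3 * m' * (s ^ 3)⁻¹ := by
        simp only [pow_succ, pow_zero, one_mul, mul_inv_rev, mul_assoc]
      rw [← e1, e2, hs3]; simp
    rw [pow_eq_pow_iff_modEq, hm'] at hcube
    have hk1 : k ≡ 1 [MOD 11] := by
      rw [← ZMod.natCast_eq_natCast_iff] at hcube ⊢
      push_cast at hcube ⊢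
      generalize (k : ZMod 11) = u at hcube
      exact cube11 u hcube
    have hcomm : s * m' * s⁻¹ = m' := by
      rw [← hk]
      conv_rhs => rw [← pow_one m']
      rw [pow_eq_pow_iff_modEq, hm']; exact hk1
    have hm11 : m' ^ 11 = 1 := by rw [← hm']; exact pow_orderOf_eq_one _
    have hm1 : m' ≠ 1 := fun e => by rw [e, orderOf_one] at hm'; omega
    have hcm : Commute s m' := by
      have := congrArg (· * s) hcomm
      simpa [Commute, SemiconjBy] using this
    have : ∃ x : R, m' • x ≠ x := by
      by_contra hcon; push Not at hcon; exact hm1 (c.faithR m' hcon)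
    obtain ⟨x, hx⟩ := this
    have hbij := (Fintype.bijective_iff_injective_and_card _).2
      ⟨inj11 m' hm11 x hx, by rw [c.cR]; simp⟩
    obtain ⟨i, hi⟩ := hbij.2 r
    have hsx : s • x = x := by
      apply smul_left_cancel (m' ^ (i : ℕ))
      rw [← mul_smul, ← (hcm.pow_right i).eq, mul_smul]
      simp only at hi
      rw [hi, hsr]
    apply hs1
    refine c.faithR s fun z => ?_
    obtain ⟨j, hj⟩ := hbij.2 z
    simp only at hj
    rw [← hj, ← mul_smul, (hcm.pow_right j).eq, mul_smul, hsx]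
  · have hAN : A ≤ N := Subgroup.subgroupOf_eq_top.1 ht
    have d60 : 60 ∣ Nat.card Ny := by
      rw [← hc]
      let ψ : A →* Ny :=
        { toFun := fun a => ⟨⟨a, hAN a.2⟩, ((hA a).1 a.2).1⟩
          map_one' := rfl
          map_mul' := fun _ _ => rfl }
      refine Subgroup.card_dvd_of_injective ψ ?_
      intro a b e
      exact Subtype.ext (congrArg (fun z : Ny => ((z : N) : G)) e)
    have : 7920 ∣ Nat.card N := by
      rw [← k12]
      have : 660 ∣ Nat.card Ny := Nat.Coprime.mul_dvd_of_dvd_of_dvd (by norm_num) d60 d11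
      exact Nat.mul_dvd_mul_right this 12
    apply Subgroup.eq_top_of_card_eq
    rw [hcard]
    exact Nat.dvd_antisymm hdvd this
end
end M11

namespace M11

theorem frob1 (A K L : Type) [CommRing A] [IsDomain A] [IsIntegrallyClosed A] [IsNoetherianRing A]
    [Field K] [Field L] [Algebra A K] [IsFractionRing A K] [Algebra K L] [FiniteDimensional K L]
    [IsGalois K L] [Algebra A L] [IsScalarTower A K L] (p : ℕ) [Fact p.Prime] (π : A →+* ZMod p) :
    ∃ (k : Type) (_ : Field k) (ρ : integralClosure A L →+* k) (ι : ZMod p →+* k) (σ : L ≃ₐ[K] L),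
      (∀ a, ρ (algebraMap A _ a) = ι (π a)) ∧
      ∀ s s' : integralClosure A L, σ s = s' → ρ s' = ρ s ^ p := by
  let B := integralClosure A L
  let := IsIntegralClosure.MulSemiringAction A K L B
  have hfr : IsFractionRing B L := IsIntegralClosure.isFractionRing_of_finite_extension A K L B
  have hsc : SMulCommClass Gal(L/K) A B := ⟨fun g a b => map_smul (galRestrict A K L B g) a b⟩
  have hinv : Algebra.IsInvariant A B Gal(L/K) := Algebra.isInvariant_of_isGalois A K L B
  have hfinB : Module.Finite A B := IsIntegralClosure.finite A K L B
  have hsurj : Function.Surjective π := ZMod.ringHom_surjective π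
  let P : Ideal A := RingHom.ker π
  have hP : P.IsMaximal := RingHom.ker_isMaximal_of_surjective π hsurj
  have hinjAB : Function.Injective (algebraMap A B) := by
    have h1 : Function.Injective (algebraMap A L) := by
      rw [IsScalarTower.algebraMap_eq A K L]
      exact (algebraMap K L).injective.comp (IsFractionRing.injective A K)
    intro a b h
    exact h1 (congrArg Subtype.val h)
  have : Algebra.IsIntegral A B := inferInstance
  obtain ⟨Q, hQm, hQ⟩ := Ideal.exists_ideal_over_maximal_of_isIntegral (S := B) P (by
    rw [(RingHom.injective_iff_ker_eq_bot _).1 hinjAB]; exact bot_le)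
  have hQP : Q.under A = P := hQ
  have : Q.LiesOver P := ⟨hQP.symm⟩
  have eP : (A ⧸ P) ≃+* ZMod p := RingHom.quotientKerEquivOfSurjective hsurj
  have hfinP : Finite (A ⧸ P) := Finite.of_equiv _ eP.symm.toEquiv
  have hcP : Nat.card (A ⧸ P) = p := by rw [Nat.card_congr eP.toEquiv, Nat.card_zmod]
  have : Module.Finite (A ⧸ P) (B ⧸ Q) := inferInstance
  have hfinQ : Finite (B ⧸ Q) := Module.finite_of_finite (A ⧸ P)
  have : Q.IsPrime := hQm.isPrime
  obtain ⟨σ, hσ⟩ := IsArithFrobAt.exists_of_isInvariant A Gal(L/K) Q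
  have hker : ∀ a : A, π a = 0 → (Ideal.Quotient.mk Q).comp (algebraMap A B) a = 0 := by
    intro a ha
    have : a ∈ Q.under A := by rw [hQP]; exact ha
    exact Ideal.Quotient.eq_zero_iff_mem.2 this
  let ι : ZMod p →+* (B ⧸ Q) := RingHom.liftOfSurjective π hsurj ⟨_, hker⟩
  refine ⟨B ⧸ Q, Ideal.Quotient.field Q, Ideal.Quotient.mk Q, ι, σ, ?_, ?_⟩
  · intro a
    have := RingHom.liftOfRightInverse_comp_apply π _ (Function.rightInverse_surjInv hsurj) ⟨_, hker⟩ a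
    exact this.symm
  · intro s s' h
    have h1 := hσ s
    rw [hQP, hcP] at h1
    have h2 : MulSemiringAction.toAlgHom A B σ s = s' := by
      apply Subtype.ext
      rw [← h]
      have := algebraMap_galRestrict_apply A (K := K) (L := L) (B := B) σ s
      exact this
    rw [h2] at h1
    rw [← map_pow]
    exact Ideal.Quotient.eq.2 h1

theorem frob2 (Z K L : Type) [CommRing Z] [IsDomain Z] [IsIntegrallyClosed Z] [IsNoetherianRing Z]
    [Field K] [Field L] [Algebra Z K] [IsFractionRing Z K] [Algebra K L] [FiniteDimensional K L]
    [IsGalois K L] (p : ℕ) [Fact p.Prime] (π : Z →+* ZMod p) :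
    ∃ (k : Type) (_ : Field k) (S : Subring L) (ρ : S →+* k) (ι : ZMod p →+* k) (σ : L ≃ₐ[K] L)
      (j : Z →+* S), (∀ z, (j z : L) = algebraMap K L (algebraMap Z K z)) ∧
      (∀ z, ρ (j z) = ι (π z)) ∧
      (∀ h : Polynomial Z, π h.leadingCoeff ≠ 0 → ∀ x : L,
        h.eval₂ ((algebraMap K L).comp (algebraMap Z K)) x = 0 → x ∈ S) ∧
      ∀ s s' : S, σ s = s' → ρ s' = ρ s ^ p := by
  let P : Ideal Z := RingHom.ker π
  have hP : P.IsPrime := RingHom.ker_isPrime π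
  let A := Localization.AtPrime P
  have hu : ∀ y : P.primeCompl, IsUnit (algebraMap Z K y) := by
    intro y
    rw [isUnit_iff_ne_zero]
    intro h
    have := (IsFractionRing.injective Z K) (h.trans (map_zero _).symm)
    exact y.2 (by rw [this]; exact P.zero_mem)
  let : Algebra A K := (IsLocalization.lift (M := P.primeCompl) hu).toAlgebra
  have : IsScalarTower Z A K := IsScalarTower.of_algebraMap_eq' (IsLocalization.lift_comp hu).symm
  have : IsFractionRing A K :=
    IsFractionRing.isFractionRing_of_isDomain_of_isLocalization P.primeCompl A K
  have : IsIntegrallyClosed A :=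
    isIntegrallyClosed_of_isLocalization A P.primeCompl P.primeCompl_le_nonZeroDivisors
  have : IsNoetherianRing A := IsLocalization.isNoetherianRing P.primeCompl A inferInstance
  let : Algebra A L := ((algebraMap K L).comp (algebraMap A K)).toAlgebra
  have : IsScalarTower A K L := IsScalarTower.of_algebraMap_eq' rfl
  have hu2 : ∀ y : P.primeCompl, IsUnit (π y) := by
    intro y
    rw [isUnit_iff_ne_zero]
    exact fun h => y.2 h
  let πA : A →+* ZMod p := IsLocalization.lift (M := P.primeCompl) hu2
  obtain ⟨k, hk, ρ, ι, σ, h1, h2⟩ := frob1 A K L p πA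
  have hA : ∀ z : Z, algebraMap A L (algebraMap Z A z) = algebraMap K L (algebraMap Z K z) := by
    intro z
    rw [IsScalarTower.algebraMap_apply A K L, ← IsScalarTower.algebraMap_apply Z A K]
  refine ⟨k, hk, (integralClosure A L).toSubring, ρ, ι, σ,
    (algebraMap A (integralClosure A L)).comp (algebraMap Z A), ?_, ?_, ?_, h2⟩
  · intro z
    exact hA z
  · intro z
    rw [RingHom.comp_apply]
    refine (h1 _).trans ?_
    congr 1
    exact IsLocalization.lift_eq hu2 z
  · intro h hl x hx
    have hunit : IsUnit (algebraMap Z A h.leadingCoeff) :=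
      IsLocalization.map_units A (⟨h.leadingCoeff, hl⟩ : P.primeCompl)
    obtain ⟨u, hu'⟩ := hunit
    have hne : algebraMap Z A h.leadingCoeff ≠ 0 := by rw [← hu']; exact u.ne_zero
    change IsIntegral A x
    refine ⟨Polynomial.C (↑u⁻¹ : A) * h.map (algebraMap Z A), ?_, ?_⟩
    · rw [Polynomial.Monic, Polynomial.leadingCoeff_mul, Polynomial.leadingCoeff_C,
        Polynomial.leadingCoeff_map_of_leadingCoeff_ne_zero _ hne, ← hu']
      simp
    · rw [Polynomial.eval₂_mul, Polynomial.eval₂_map]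
      have : (algebraMap A L).comp (algebraMap Z A) = (algebraMap K L).comp (algebraMap Z K) :=
        RingHom.ext hA
      rw [this, hx, mul_zero]
end M11

namespace M11
open Polynomial

theorem frob3 (Z K L : Type) [CommRing Z] [IsDomain Z] [IsIntegrallyClosed Z] [IsNoetherianRing Z]
    [Field K] [Field L] [Algebra Z K] [IsFractionRing Z K] [Algebra K L] [FiniteDimensional K L]
    [IsGalois K L] (p : ℕ) [Fact p.Prime] (π : Z →+* ZMod p) :
    ∃ (k : Type) (_ : Field k) (r : L → k) (ι : ZMod p →+* k) (σ : L ≃ₐ[K] L),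
      ∀ h : Polynomial Z, π h.leadingCoeff ≠ 0 →
        (h.map ((algebraMap K L).comp (algebraMap Z K))).Splits →
        (h.map π).map ι = C (ι (π h.leadingCoeff)) *
          ((h.map ((algebraMap K L).comp (algebraMap Z K))).roots.map (fun x => X - C (r x))).prod ∧
        ∀ x ∈ (h.map ((algebraMap K L).comp (algebraMap Z K))).roots, r (σ x) = r x ^ p := by
  classical
  obtain ⟨k, hk, S, ρ, ι, σ, j, h1, h2, h3, h4⟩ := frob2 Z K L p π
  let r : L → k := fun x => if hx : x ∈ S then ρ ⟨x, hx⟩ else 0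
  have hr : ∀ x (hx : x ∈ S), r x = ρ ⟨x, hx⟩ := fun x hx => by simp [r, hx]
  refine ⟨k, hk, r, ι, σ, fun h hl hs => ?_⟩
  set φ := (algebraMap K L).comp (algebraMap Z K) with hφ
  have hφj : φ = S.subtype.comp j := RingHom.ext fun z => (h1 z).symm
  have hφinj : Function.Injective φ :=
    (algebraMap K L).injective.comp (IsFractionRing.injective Z K)
  have hl0 : h.leadingCoeff ≠ 0 := fun e => hl (by rw [e, map_zero])
  have hroot : ∀ x, x ∈ (h.map φ).roots → h.eval₂ φ x = 0 := by
    intro x hx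
    have := isRoot_of_mem_roots hx
    rwa [IsRoot, eval_map] at this
  have hmem : ∀ x, x ∈ (h.map φ).roots → x ∈ S := fun x hx => h3 h hl x (hroot x hx)
  constructor
  · have e1 := hs.eq_prod_roots
    rw [leadingCoeff_map_of_injective hφinj] at e1
    -- lift to S
    let M : Multiset S := (h.map φ).roots.pmap (fun x hx => (⟨x, hx⟩ : S)) hmem
    have hM : M.map S.subtype = (h.map φ).roots := by
      simp [M, Multiset.map_pmap, Multiset.pmap_eq_map]
    have e2 : h.map j = C (j h.leadingCoeff) * (M.map (fun s => X - C s)).prod := by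
      apply Polynomial.map_injective S.subtype Subtype.val_injective
      rw [Polynomial.map_map, ← hφj, e1, Polynomial.map_mul, map_C, Polynomial.map_multiset_prod,
        Multiset.map_map]
      congr 1
      · rw [hφj]; rfl
      · rw [← hM, Multiset.map_map]
        congr 1
        refine Multiset.map_congr rfl fun s _ => ?_
        simp
    have e3 : (h.map π).map ι = (h.map j).map ρ := by
      rw [Polynomial.map_map, Polynomial.map_map]
      congr 1
      exact RingHom.ext fun z => (h2 z).symm
    rw [e3, e2, Polynomial.map_mul, map_C, h2, Polynomial.map_multiset_prod, Multiset.map_map]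
    congr 2
    rw [← hM, Multiset.map_map]
    refine Multiset.map_congr rfl fun s _ => ?_
    simp [hr]
  · intro x hx
    have hx' : σ x ∈ S := by
      apply h3 h hl
      have : h.eval₂ φ (σ x) = σ (h.eval₂ φ x) := by
        have e : φ = (σ : L →+* L).comp φ := by
          ext z; simp [hφ]
        conv_lhs => rw [e]
        exact (Polynomial.hom_eval₂ h φ (σ : L →+* L) x).symm
      rw [this, hroot x hx, map_zero]
    rw [hr x (hmem x hx), hr _ hx']
    exact h4 ⟨x, hmem x hx⟩ ⟨σ x, hx'⟩ rfl

section
variable {p : ℕ} [Fact p.Prime] {k L : Type} [Field k] (ι : ZMod p →+* k) (r : L → k)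
  (σ : L → L) (M : Multiset L) (H : (ZMod p)[X]) (c : ZMod p) (hc : c ≠ 0)
  (h1 : H.map ι = C (ι c) * (M.map (fun x => X - C (r x))).prod)
  (h2 : ∀ x ∈ M, r (σ x) = r x ^ p) (h3 : ∀ x ∈ M, σ x ∈ M)
include hc h1

lemma red_roots : (H.map ι).roots = M.map r := by
  rw [h1, roots_C_mul _ (by simpa using hc)]
  have : M.map (fun x => X - C (r x)) = (M.map r).map (fun a => X - C a) := by
    rw [Multiset.map_map]; rfl
  rw [this, roots_multiset_prod_X_sub_C]

lemma red_nodup (m : ℕ) (hm : m ≠ 0) (hd : H ∣ X ^ (p ^ m) - X) : (M.map r).Nodup := by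
  rw [← red_roots ι r M H c hc h1]
  apply nodup_roots
  have hchar : CharP k p := charP_of_injective_ringHom ι.injective p
  have : H.map ι ∣ X ^ (p ^ m) - X := by
    have := Polynomial.map_dvd ι hd
    simpa using this
  exact (galois_poly_separable p (p ^ m) (dvd_pow_self p hm)).of_dvd this

include h2

lemma red_fix (hn : (M.map r).Nodup) (x : L) (hx : x ∈ M) (hx' : σ x ∈ M) :
    (σ x = x ↔ ∃ a : ZMod p, H.eval a = 0 ∧ ι a = r x) := by
  have hinj : ∀ x ∈ M, ∀ y ∈ M, r x = r y → x = y := fun x hx y hy =>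
    Multiset.inj_on_of_nodup_map hn x hx y hy
  have hchar : CharP k p := charP_of_injective_ringHom ι.injective p
  constructor
  · intro e
    have h := h2 x hx
    rw [e] at h
    have : r x ∈ (⊥ : Subfield k) := (Subfield.mem_bot_iff_pow_eq_self k p).2 h.symm
    have h4 : r x ∈ ι.fieldRange := (bot_le : (⊥ : Subfield k) ≤ _) this
    obtain ⟨a, ha⟩ := h4
    refine ⟨a, ?_, ha⟩
    apply ι.injective
    rw [map_zero, ← eval_map_apply, ha]
    have : r x ∈ (H.map ι).roots := by
      rw [red_roots ι r M H c hc h1]; exact Multiset.mem_map_of_mem _ hx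
    exact isRoot_of_mem_roots this
  · rintro ⟨a, -, ha⟩
    apply hinj _ hx' _ hx
    rw [h2 x hx, ← ha, ← map_pow, ZMod.pow_card]

lemma red_nofix (x : L) (hx : x ∈ M) (e : σ x = x) : ∃ a : ZMod p, H.eval a = 0 ∧ ι a = r x := by
  have hchar : CharP k p := charP_of_injective_ringHom ι.injective p
  have h := h2 x hx
  rw [e] at h
  have : r x ∈ (⊥ : Subfield k) := (Subfield.mem_bot_iff_pow_eq_self k p).2 h.symm
  have h4 : r x ∈ ι.fieldRange := (bot_le : (⊥ : Subfield k) ≤ _) this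
  obtain ⟨a, ha⟩ := h4
  refine ⟨a, ?_, ha⟩
  apply ι.injective
  rw [map_zero, ← eval_map_apply, ha]
  have : r x ∈ (H.map ι).roots := by
    rw [red_roots ι r M H c hc h1]; exact Multiset.mem_map_of_mem _ hx
  exact isRoot_of_mem_roots this

include h3

lemma red_pow (m : ℕ) (hm : m ≠ 0) (hd : H ∣ X ^ (p ^ m) - X) (x : L) (hx : x ∈ M) :
    σ^[m] x = x := by
  have hn := red_nodup ι r M H c hc h1 m hm hd
  have hit : ∀ i : ℕ, σ^[i] x ∈ M ∧ r (σ^[i] x) = r x ^ (p ^ i) := by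
    intro i
    induction i with
    | zero => simp [hx]
    | succ i ih =>
      rw [Function.iterate_succ_apply']
      exact ⟨h3 _ ih.1, by rw [h2 _ ih.1, ih.2, ← pow_mul, pow_succ]⟩
  refine Multiset.inj_on_of_nodup_map hn _ (hit m).1 _ hx ?_
  rw [(hit m).2]
  have hr : r x ∈ (H.map ι).roots := by
    rw [red_roots ι r M H c hc h1]; exact Multiset.mem_map_of_mem _ hx
  have hd' : H.map ι ∣ X ^ (p ^ m) - X := by
    have := Polynomial.map_dvd ι hd
    simpa using this
  have := (isRoot_of_mem_roots hr).dvd hd'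
  simpa [IsRoot, sub_eq_zero] using this

lemma red_ex (m : ℕ) (hm : m ≠ 0) (hd : H ∣ X ^ (p ^ m) - X) (a : ZMod p) (ha : H.eval a = 0) :
    ∃ x ∈ M, σ x = x := by
  have hn := red_nodup ι r M H c hc h1 m hm hd
  have hne : H.map ι ≠ 0 := by
    rw [h1]
    refine mul_ne_zero (by simpa using hc) ?_
    apply Multiset.prod_ne_zero
    intro h
    obtain ⟨x, -, hx⟩ := Multiset.mem_map.1 h
    exact X_sub_C_ne_zero _ hx
  have : ι a ∈ (H.map ι).roots := by
    rw [mem_roots hne, IsRoot, eval_map_apply, ha, map_zero]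
  rw [red_roots ι r M H c hc h1, Multiset.mem_map] at this
  obtain ⟨x, hx, hxa⟩ := this
  exact ⟨x, hx, (red_fix ι r σ M H c hc h1 h2 hn x hx (h3 x hx)).2 ⟨a, ha, hxa.symm⟩⟩

lemma red_move (m : ℕ) (hm : m ≠ 0) (hd : H ∣ X ^ (p ^ m) - X)
    (hlt : (Finset.univ.filter (fun a : ZMod p => H.eval a = 0)).card < Multiset.card M) :
    ∃ x ∈ M, σ x ≠ x := by
  classical
  by_contra hcon
  push Not at hcon
  have hn := red_nodup ι r M H c hc h1 m hm hd
  have : M.map r ⊆ ((Finset.univ.filter (fun a : ZMod p => H.eval a = 0)).image ι).val := by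
    intro y hy
    obtain ⟨x, hx, rfl⟩ := Multiset.mem_map.1 hy
    obtain ⟨a, h4, h5⟩ := (red_fix ι r σ M H c hc h1 h2 hn x hx (h3 x hx)).1 (hcon x hx)
    simp only [Finset.mem_val, Finset.mem_image, Finset.mem_filter, Finset.mem_univ, true_and]
    exact ⟨a, h4, h5⟩
  have := Multiset.card_le_card ((Multiset.le_iff_subset hn).2 this)
  rw [Multiset.card_map] at this
  have h6 := Finset.card_image_le (s := Finset.univ.filter (fun a : ZMod p => H.eval a = 0)) (f := ι)
  rw [Finset.card_val] at this
  omega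
end
end M11

namespace M11

section
variable {R : Type} [CommRing R]

def pF (x : R) : R := (77 * x ^ 3 + 10989 * x ^ 2 + 129816 * x + 496368) ^ 3 *
      (77 * x ^ 2 + 2376 * x + 15472)
def qF (x : R) : R := (11 * x ^ 2 - 1296) ^ 4 * (11 * x ^ 2 + 143 * x + 621)
def pG (y : R) : R := (3236 * y ^ 3 + 4488 * y ^ 2 - 10857 * y - 15609) *
  (-12 * y ^ 3 - 56 * y ^ 2 + 99 * y + 143) ^ 3
def qG (y : R) : R := (11 - y ^ 2) ^ 2 * (11 - 4 * y ^ 2) ^ 4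

lemma map_pF {S : Type} [CommRing S] (φ : R →+* S) (x : R) : φ (pF x) = pF (φ x) := by simp [pF, map_ofNat]
lemma map_qF {S : Type} [CommRing S] (φ : R →+* S) (x : R) : φ (qF x) = qF (φ x) := by simp [qF, map_ofNat]
lemma map_pG {S : Type} [CommRing S] (φ : R →+* S) (x : R) : φ (pG x) = pG (φ x) := by simp [pG, map_ofNat]
lemma map_qG {S : Type} [CommRing S] (φ : R →+* S) (x : R) : φ (qG x) = qG (φ x) := by simp [qG, map_ofNat]

/-- Horner evaluation of a list of coefficients. -/
def ev (θ : R) : List ℕ → R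
  | [] => 0
  | a :: l => (a : R) + θ * ev θ l
end

def ladd : List ℕ → List ℕ → List ℕ
  | [], l => l
  | a :: l, [] => a :: l
  | a :: l, b :: m => ((a + b) % 23) :: ladd l m

def lscale (c : ℕ) : List ℕ → List ℕ
  | [] => []
  | a :: l => ((c * a) % 23) :: lscale c l

def lred (n : ℕ) (m l : List ℕ) : List ℕ :=
  match (0 :: l).drop n with
  | [] => 0 :: l
  | [d] => ladd ((0 :: l).take n) (lscale d m)
  | _ :: _ :: _ => 0 :: l

def lmul (n : ℕ) (m : List ℕ) : List ℕ → List ℕ → List ℕ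
  | [], _ => []
  | a :: l, b => ladd (lscale a b) (lred n m (lmul n m l b))

/-- the 23rd power -/
def lpow (n : ℕ) (m a : List ℕ) : List ℕ :=
  let a2 := lmul n m a a
  let a4 := lmul n m a2 a2
  let a5 := lmul n m a4 a
  let a10 := lmul n m a5 a5
  let a11 := lmul n m a10 a
  let a22 := lmul n m a11 a11
  lmul n m a22 a

def lfrob (n : ℕ) (m : List ℕ) : ℕ → List ℕ
  | 0 => [0, 1]
  | k + 1 => lpow n m (lfrob n m k)

section
variable {R : Type} [CommRing R] (h23 : (23 : R) = 0) (θ : R)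
include h23

lemma cast_mod (a : ℕ) : ((a % 23 : ℕ) : R) = a := by
  conv_rhs => rw [← Nat.mod_add_div a 23]
  push_cast
  rw [h23]; ring

lemma ev_ladd : ∀ a b : List ℕ, ev θ (ladd a b) = ev θ a + ev θ b
  | [], l => by simp [ladd, ev]
  | a :: l, [] => by simp [ladd, ev]
  | a :: l, b :: m => by
    simp only [ladd, ev, cast_mod h23, ev_ladd l m]; push_cast; ring

lemma ev_lscale (c : ℕ) : ∀ a : List ℕ, ev θ (lscale c a) = c * ev θ a
  | [] => by simp [lscale, ev]
  | a :: l => by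
    simp only [lscale, ev, cast_mod h23, ev_lscale c l]; push_cast; ring

omit h23 in
lemma ev_append : ∀ a b : List ℕ, ev θ (a ++ b) = ev θ a + θ ^ a.length * ev θ b
  | [], l => by simp [ev]
  | a :: l, b => by
    simp only [List.cons_append, ev, ev_append l b, List.length_cons]; ring

variable (n : ℕ) (m : List ℕ) (hm : θ ^ n = ev θ m)
include hm

lemma ev_lred (l : List ℕ) : ev θ (lred n m l) = θ * ev θ l := by
  have h0 : ev θ (0 :: l) = θ * ev θ l := by simp [ev]
  unfold lred
  split
  · exact h0
  · rename_i d hd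
    rw [ev_ladd h23, ev_lscale h23, ← h0]
    conv_rhs => rw [← List.take_append_drop n (0 :: l), ev_append, hd]
    have hlen : ((0 :: l).take n).length = n := by
      have := congrArg List.length hd
      rw [List.length_drop] at this
      rw [List.length_take]
      simp at this ⊢
      omega
    rw [hlen, hm]
    simp [ev]; ring
  · exact h0

lemma ev_lmul : ∀ a b : List ℕ, ev θ (lmul n m a b) = ev θ a * ev θ b
  | [], l => by simp [lmul, ev]
  | a :: l, b => by
    simp only [lmul, ev, ev_ladd h23, ev_lscale h23, ev_lred h23 θ n m hm, ev_lmul l b]; ring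

lemma ev_lpow (a : List ℕ) : ev θ (lpow n m a) = ev θ a ^ 23 := by
  simp only [lpow, ev_lmul h23 θ n m hm]; ring

lemma ev_lfrob (k : ℕ) : ev θ (lfrob n m k) = θ ^ (23 ^ k) := by
  induction k with
  | zero => simp [lfrob, ev]
  | succ k ih => rw [lfrob, ev_lpow h23 θ n m hm, ih, ← pow_mul, pow_succ]

omit hm in
lemma frob_of_list (n : ℕ) (m : List ℕ) (hm : θ ^ n = ev θ m) (k : ℕ)
    (h : lfrob n m k = 0 :: 1 :: List.replicate (n - 2) 0) : θ ^ (23 ^ k) = θ := by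
  rw [← ev_lfrob h23 θ n m hm k, h]
  have : ∀ j, ev θ (List.replicate j 0) = 0 := by
    intro j; induction j with
    | zero => rfl
    | succ j ih => simp [List.replicate_succ, ev, ih]
  simp [ev, this]
end

lemma frobF4 {R : Type} [CommRing R] (h23 : (23 : R) = 0) (θ : R)
    (h : pF θ - 4 * qF θ = 0) : θ ^ (23 ^ 11) = θ := by
  refine frob_of_list h23 θ 11 [12, 0, 11, 19, 8, 22, 9, 4, 7, 17, 11] ?_ 11 ?_
  · simp only [pF, qF] at h
    simp only [ev, Nat.cast_ofNat, Nat.cast_zero, Nat.cast_one]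
    linear_combination 12 * h + ((-987210088512152050644) * θ ^ 0 + (-926166601494644391936) * θ ^ 1 + (-392001214511663703085) * θ ^ 2 + (-97447502238847213925) * θ ^ 3 + (-15560332388286027064) * θ ^ 4 + (-1640785536520884314) * θ ^ 5 + (-113092262224728543) * θ ^ 6 + (-4863778630294940) * θ ^ 7 + (-119163770939957) * θ ^ 8 + (-1459404426211) * θ ^ 9 + (-8418053017) * θ ^ 10 + (-18340717) * θ ^ 11) * h23
  · decide +kernel

lemma frobF3 {R : Type} [CommRing R] (h23 : (23 : R) = 0) (θ : R)
    (h : pF θ - 3 * qF θ = 0) : θ ^ (23 ^ 3) = θ := by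
  refine frob_of_list h23 θ 11 [12, 18, 0, 12, 11, 12, 10, 17, 8, 19, 20] ?_ 3 ?_
  · simp only [pF, qF] at h
    simp only [ev, Nat.cast_ofNat, Nat.cast_zero, Nat.cast_one]
    linear_combination 12 * h + ((-987211002551762066388) * θ ^ 0 + (-926166811973974878654) * θ ^ 1 + (-392001199670172450816) * θ ^ 2 + (-97447495092944018388) * θ ^ 3 + (-15560332233687159853) * θ ^ 4 + (-1640785627498818516) * θ ^ 5 + (-113092266987462278) * θ ^ 6 + (-4863778115502103) * θ ^ 7 + (-119163736084192) * θ ^ 8 + (-1459405518557) * θ ^ 9 + (-8418137044) * θ ^ 10 + (-18340717) * θ ^ 11) * h23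
  · decide +kernel

lemma frobF6 {R : Type} [CommRing R] (h23 : (23 : R) = 0) (θ : R)
    (h : pF θ - 6 * qF θ = 0) : θ ^ (23 ^ 5) = θ := by
  refine frob_of_list h23 θ 11 [12, 10, 10, 10, 2, 19, 7, 1, 5, 13, 16] ?_ 5 ?_
  · simp only [pF, qF] at h
    simp only [ev, Nat.cast_ofNat, Nat.cast_zero, Nat.cast_one]
    linear_combination 12 * h + ((-987208260432932019156) * θ ^ 0 + (-926166180535983418502) * θ ^ 1 + (-392001244194646207622) * θ ^ 2 + (-97447516530653604998) * θ ^ 3 + (-15560332697483761486) * θ ^ 4 + (-1640785354565015909) * θ ^ 5 + (-113092252699261073) * θ ^ 6 + (-4863779659880615) * θ ^ 7 + (-119163840651487) * θ ^ 8 + (-1459402241519) * θ ^ 9 + (-8417884964) * θ ^ 10 + (-18340717) * θ ^ 11) * h23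
  · decide +kernel

lemma frobG4 {R : Type} [CommRing R] (h23 : (23 : R) = 0) (θ : R)
    (h : pG θ - 4 * qG θ = 0) : θ ^ (23 ^ 11) = θ := by
  refine frob_of_list h23 θ 12 [13, 20, 13, 13, 5, 12, 20, 12, 6, 11, 20, 22] ?_ 11 ?_
  · simp only [pG, qG] at h
    simp only [ev, Nat.cast_ofNat, Nat.cast_zero, Nat.cast_one]
    linear_combination 18 * h + ((35726895631) * θ ^ 0 + (99036847076) * θ ^ 1 + (50720363065) * θ ^ 2 + (-77448755771) * θ ^ 3 + (-72635592529) * θ ^ 4 + (16827547692) * θ ^ 5 + (29390244116) * θ ^ 6 + (854745132) * θ ^ 7 + (-4818626346) * θ ^ 8 + (-702948397) * θ ^ 9 + (247862516) * θ ^ 10 + (67336102) * θ ^ 11 + (4376999) * θ ^ 12) * h23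
  · decide +kernel

lemma frobG3 {R : Type} [CommRing R] (h23 : (23 : R) = 0) (θ : R)
    (h : pG θ - 3 * qG θ = 0) : θ ^ (23 ^ 3) = θ := by
  refine frob_of_list h23 θ 12 [9, 15, 0, 4, 2, 9, 14, 9, 21, 14, 6, 5] ?_ 3 ?_
  · simp only [pG, qG] at h
    simp only [ev, Nat.cast_ofNat, Nat.cast_zero, Nat.cast_one]
    linear_combination 2 * h + ((3969501021) * θ ^ 0 + (11004094119) * θ ^ 1 + (5635847976) * θ ^ 2 + (-8605417308) * θ ^ 3 + (-8070785626) * θ ^ 4 + (1869727521) * θ ^ 5 + (3265636382) * θ ^ 6 + (94971681) * θ ^ 7 + (-535412019) * θ ^ 8 + (-78105378) * θ ^ 9 + (27541014) * θ ^ 10 + (7481789) * θ ^ 11 + (486311) * θ ^ 12) * h23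
  · decide +kernel

lemma frobG6 {R : Type} [CommRing R] (h23 : (23 : R) = 0) (θ : R)
    (h : pG θ - 6 * qG θ = 0) : θ ^ (23 ^ 5) = θ := by
  refine frob_of_list h23 θ 12 [22, 14, 2, 16, 6, 13, 22, 13, 1, 10, 17, 20] ?_ 5 ?_
  · simp only [pG, qG] at h
    simp only [ev, Nat.cast_ofNat, Nat.cast_zero, Nat.cast_one]
    linear_combination 8 * h + ((15879852670) * θ ^ 0 + (44016376478) * θ ^ 1 + (22540366946) * θ ^ 2 + (-34421669232) * θ ^ 3 + (-32281171698) * θ ^ 4 + (7478910085) * θ ^ 5 + (13061901094) * θ ^ 6 + (379886725) * θ ^ 7 + (-2141538983) * θ ^ 8 + (-312421510) * θ ^ 9 + (110155241) * θ ^ 10 + (29927156) * θ ^ 11 + (1945511) * θ ^ 12) * h23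
  · decide +kernel

end M11

namespace M11
open Polynomial

structure Good {L : Type} (p : ℕ) [Fact p.Prime] (σ : L → L) (M : Multiset L) (H : (ZMod p)[X]) : Prop where
  nodup : ∀ m, m ≠ 0 → H ∣ X ^ (p ^ m) - X → M.Nodup
  pow : ∀ m, m ≠ 0 → H ∣ X ^ (p ^ m) - X → ∀ x ∈ M, σ^[m] x = x
  ex : ∀ m, m ≠ 0 → H ∣ X ^ (p ^ m) - X → ∀ a, H.eval a = 0 → ∃ x ∈ M, σ x = x
  move : ∀ m, m ≠ 0 → H ∣ X ^ (p ^ m) - X →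
    (Finset.univ.filter (fun a : ZMod p => H.eval a = 0)).card < Multiset.card M → ∃ x ∈ M, σ x ≠ x
  nofix : (∀ a, H.eval a ≠ 0) → ∀ x ∈ M, σ x ≠ x

theorem frob4 (Z K L : Type) [CommRing Z] [IsDomain Z] [IsIntegrallyClosed Z] [IsNoetherianRing Z]
    [Field K] [Field L] [Algebra Z K] [IsFractionRing Z K] [Algebra K L] [FiniteDimensional K L]
    [IsGalois K L] (p : ℕ) [Fact p.Prime] (π : Z →+* ZMod p) :
    ∃ (σ : L ≃ₐ[K] L),
      ∀ h : Polynomial Z, π h.leadingCoeff ≠ 0 →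
        ((h.map (algebraMap Z K)).map (algebraMap K L)).Splits →
        Good p σ ((h.map (algebraMap Z K)).map (algebraMap K L)).roots (h.map π) := by
  obtain ⟨k, hk, r, ι, σ, hh⟩ := frob3 Z K L p π
  refine ⟨σ, fun h hl hs => ?_⟩
  have hφinj : Function.Injective ((algebraMap K L).comp (algebraMap Z K)) :=
    (algebraMap K L).injective.comp (IsFractionRing.injective Z K)
  rw [Polynomial.map_map] at hs ⊢
  obtain ⟨h1, h2⟩ := hh h hl hs
  have h3 : ∀ x ∈ (h.map ((algebraMap K L).comp (algebraMap Z K))).roots,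
      σ x ∈ (h.map ((algebraMap K L).comp (algebraMap Z K))).roots := by
    intro x hx
    have hne := ne_zero_of_mem_roots hx
    rw [mem_roots hne, IsRoot, eval_map] at hx ⊢
    have : h.eval₂ ((algebraMap K L).comp (algebraMap Z K)) (σ x)
        = σ (h.eval₂ ((algebraMap K L).comp (algebraMap Z K)) x) := by
      have e : ((algebraMap K L).comp (algebraMap Z K))
        = (σ : L →+* L).comp ((algebraMap K L).comp (algebraMap Z K)) := by
        ext z; simp
      conv_lhs => rw [e]
      exact (Polynomial.hom_eval₂ h _ (σ : L →+* L) x).symm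
    rw [this, hx, map_zero]
  refine ⟨?_, ?_, ?_, ?_, ?_⟩
  · intro m hm hd
    exact Multiset.Nodup.of_map _ (red_nodup ι r _ _ _ hl h1 m hm hd)
  · intro m hm hd
    exact red_pow ι r σ _ _ _ hl h1 h2 h3 m hm hd
  · intro m hm hd
    exact red_ex ι r σ _ _ _ hl h1 h2 h3 m hm hd
  · intro m hm hd
    exact red_move ι r σ _ _ _ hl h1 h2 h3 m hm hd
  · intro ha x hx e
    obtain ⟨a, h4, -⟩ := red_nofix ι r σ _ _ _ hl h1 h2 x hx e
    exact ha a h4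

noncomputable def f0 : ℤ[X][X] := pF (X : ℤ[X][X]) - C (X : ℤ[X]) * qF (X : ℤ[X][X])
noncomputable def g0 : ℤ[X][X] := pG (X : ℤ[X][X]) - C (X : ℤ[X]) * qG (X : ℤ[X][X])

noncomputable def pit (t : ℤ) : ℤ[X] →+* ZMod 23 := eval₂RingHom (Int.castRingHom _) (t : ZMod 23)

lemma map_f0 {S : Type} [CommRing S] (φ : ℤ[X] →+* S) : f0.map φ = pF X - C (φ X) * qF X := by
  have h1 := map_pF (mapRingHom φ) (X : ℤ[X][X])
  have h2 := map_qF (mapRingHom φ) (X : ℤ[X][X])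
  simp only [coe_mapRingHom, map_X] at h1 h2
  rw [f0, Polynomial.map_sub, Polynomial.map_mul, map_C, h1, h2]

lemma map_g0 {S : Type} [CommRing S] (φ : ℤ[X] →+* S) : g0.map φ = pG X - C (φ X) * qG X := by
  have h1 := map_pG (mapRingHom φ) (X : ℤ[X][X])
  have h2 := map_qG (mapRingHom φ) (X : ℤ[X][X])
  simp only [coe_mapRingHom, map_X] at h1 h2
  rw [g0, Polynomial.map_sub, Polynomial.map_mul, map_C, h1, h2]

lemma eval_F {S : Type} [CommRing S] (c a : S) : (pF X - C c * qF X : S[X]).eval a = pF a - c * qF a := by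
  have h1 := map_pF (evalRingHom a) (X : S[X])
  have h2 := map_qF (evalRingHom a) (X : S[X])
  simp only [coe_evalRingHom, eval_X] at h1 h2
  simp [h1, h2]

lemma eval_G {S : Type} [CommRing S] (c a : S) : (pG X - C c * qG X : S[X]).eval a = pG a - c * qG a := by
  have h1 := map_pG (evalRingHom a) (X : S[X])
  have h2 := map_qG (evalRingHom a) (X : S[X])
  simp only [coe_evalRingHom, eval_X] at h1 h2
  simp [h1, h2]

lemma degF {S : Type} [CommRing S] (c : S) : (pF X - C c * qF X : S[X]).natDegree ≤ 11 := by
  unfold pF qF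
  compute_degree

lemma coeffF {S : Type} [CommRing S] (c : S) : (pF X - C c * qF X : S[X]).coeff 11 = 77 ^ 4 := by
  unfold pF qF
  compute_degree!

lemma degG {S : Type} [CommRing S] (c : S) : (pG X - C c * qG X : S[X]).natDegree ≤ 12 := by
  unfold pG qG
  compute_degree

lemma coeffG {S : Type} [CommRing S] (c : S) :
    (pG X - C c * qG X : S[X]).coeff 12 = -3236 * 12 ^ 3 - c * 256 := by
  unfold pG qG
  compute_degree!

end M11

namespace M11
open Polynomial

lemma f0_lc : f0.leadingCoeff = 77 ^ 4 := by
  have h : f0.natDegree = 11 := natDegree_eq_of_le_of_coeff_ne_zero (degF _) (by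
    have := coeffF (X : ℤ[X]); rw [f0, this]; norm_num)
  rw [leadingCoeff, h]; exact coeffF _

lemma g0_lc_ne : (-3236 * 12 ^ 3 - X * 256 : ℤ[X]) ≠ 0 := by
  intro h
  have := congrArg (fun p : ℤ[X] => p.eval 0) h
  simp at this

lemma g0_lc : g0.leadingCoeff = -3236 * 12 ^ 3 - X * 256 := by
  have h : g0.natDegree = 12 := natDegree_eq_of_le_of_coeff_ne_zero (degG _) (by
    have := coeffG (X : ℤ[X]); rw [g0, this]; exact g0_lc_ne)
  rw [leadingCoeff, h]; exact coeffG _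

lemma pit_X (c : ℤ) : pit c X = c := by simp [pit]

lemma pit_f0 (c : ℤ) : pit c f0.leadingCoeff ≠ 0 := by
  rw [f0_lc]; simp only [map_pow, map_ofNat]; decide

lemma pit_g0 (c : ℤ) (h : (-3236 * 12 ^ 3 - (c : ZMod 23) * 256) ≠ 0) : pit c g0.leadingCoeff ≠ 0 := by
  rw [g0_lc]
  simpa only [map_sub, map_mul, map_neg, map_pow, map_ofNat, pit_X] using h

instance fact23 : Fact (Nat.Prime 23) := ⟨by norm_num⟩

lemma dvd_of {H : (ZMod 23)[X]} (N : ℕ)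
    (h : (23 : AdjoinRoot H) = 0 → (AdjoinRoot.root H) ^ N = AdjoinRoot.root H) : H ∣ X ^ N - X := by
  rw [← AdjoinRoot.mk_eq_zero, map_sub, map_pow, AdjoinRoot.mk_X, sub_eq_zero]
  apply h
  have : (23 : (ZMod 23)) = 0 := by decide
  have h2 : AdjoinRoot.of H 23 = 23 := map_ofNat _ 23
  rw [← h2, this, map_zero]

lemma dvdF (c : ZMod 23) (N : ℕ) (h : ∀ {R : Type} [CommRing R] (φ : ZMod 23 →+* R) (_ : (23 : R) = 0) (θ : R),
    pF θ - φ c * qF θ = 0 → θ ^ N = θ) : (pF X - C c * qF X : (ZMod 23)[X]) ∣ X ^ N - X := by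
  refine dvd_of N fun h23 => h (AdjoinRoot.of _) h23 _ ?_
  have := AdjoinRoot.mk_self (f := (pF X - C c * qF X : (ZMod 23)[X]))
  rwa [map_sub, map_mul, map_pF, map_qF, AdjoinRoot.mk_X, AdjoinRoot.mk_C] at this

lemma dvdG (c : ZMod 23) (N : ℕ) (h : ∀ {R : Type} [CommRing R] (φ : ZMod 23 →+* R) (_ : (23 : R) = 0) (θ : R),
    pG θ - φ c * qG θ = 0 → θ ^ N = θ) : (pG X - C c * qG X : (ZMod 23)[X]) ∣ X ^ N - X := by
  refine dvd_of N fun h23 => h (AdjoinRoot.of _) h23 _ ?_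
  have := AdjoinRoot.mk_self (f := (pG X - C c * qG X : (ZMod 23)[X]))
  rwa [map_sub, map_mul, map_pG, map_qG, AdjoinRoot.mk_X, AdjoinRoot.mk_C] at this

lemma dF4 : f0.map (pit 4) ∣ X ^ (23 ^ 11) - X := by
  rw [map_f0]; refine dvdF _ _ fun φ h θ e => frobF4 h θ ?_
  rw [pit_X] at e; simpa [map_ofNat] using e
lemma dF3 : f0.map (pit 3) ∣ X ^ (23 ^ 3) - X := by
  rw [map_f0]; refine dvdF _ _ fun φ h θ e => frobF3 h θ ?_
  rw [pit_X] at e; simpa [map_ofNat] using e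
lemma dF6 : f0.map (pit 6) ∣ X ^ (23 ^ 5) - X := by
  rw [map_f0]; refine dvdF _ _ fun φ h θ e => frobF6 h θ ?_
  rw [pit_X] at e; simpa [map_ofNat] using e
lemma dG4 : g0.map (pit 4) ∣ X ^ (23 ^ 11) - X := by
  rw [map_g0]; refine dvdG _ _ fun φ h θ e => frobG4 h θ ?_
  rw [pit_X] at e; simpa [map_ofNat] using e
lemma dG3 : g0.map (pit 3) ∣ X ^ (23 ^ 3) - X := by
  rw [map_g0]; refine dvdG _ _ fun φ h θ e => frobG3 h θ ?_
  rw [pit_X] at e; simpa [map_ofNat] using e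
lemma dG6 : g0.map (pit 6) ∣ X ^ (23 ^ 5) - X := by
  rw [map_g0]; refine dvdG _ _ fun φ h θ e => frobG6 h θ ?_
  rw [pit_X] at e; simpa [map_ofNat] using e

lemma evF (c : ℤ) (a : ZMod 23) : (f0.map (pit c)).eval a = pF a - c * qF a := by
  rw [map_f0, eval_F, pit_X]
lemma evG (c : ℤ) (a : ZMod 23) : (g0.map (pit c)).eval a = pG a - c * qG a := by
  rw [map_g0, eval_G, pit_X]

lemma zF4 : ∀ a : ZMod 23, pF a - (4 : ℤ) * qF a ≠ 0 := by decide +kernel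
lemma zG1 : ∀ a : ZMod 23, pG a - (1 : ℤ) * qG a ≠ 0 := by decide +kernel
lemma nG4 : (Finset.univ.filter (fun a : ZMod 23 => pG a - (4 : ℤ) * qG a = 0)).card = 1 := by
  decide +kernel
lemma nF3 : (Finset.univ.filter (fun a : ZMod 23 => pF a - (3 : ℤ) * qF a = 0)).card = 2 := by
  decide +kernel
lemma nF6 : (Finset.univ.filter (fun a : ZMod 23 => pF a - (6 : ℤ) * qF a = 0)).card = 1 := by
  decide +kernel
lemma rG4 : pG (8 : ZMod 23) - (4 : ℤ) * qG (8 : ZMod 23) = 0 := by decide +kernel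
lemma rF3 : pF (1 : ZMod 23) - (3 : ℤ) * qF (1 : ZMod 23) = 0 := by decide +kernel
lemma rG3 : pG (6 : ZMod 23) - (3 : ℤ) * qG (6 : ZMod 23) = 0 := by decide +kernel
lemma rF6 : pF (22 : ZMod 23) - (6 : ℤ) * qF (22 : ZMod 23) = 0 := by decide +kernel
lemma rG6 : pG (3 : ZMod 23) - (6 : ℤ) * qG (3 : ZMod 23) = 0 := by decide +kernel

structure Frobs (K L : Type) [Field K] [Field L] [Algebra K L] (F G : Multiset L) : Prop where
  nF : F.Nodup
  nG : G.Nodup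
  e11 : ∃ s : L ≃ₐ[K] L, (∀ x ∈ F, s^[11] x = x) ∧ (∀ x ∈ G, s^[11] x = x) ∧
    (∃ y ∈ G, s y = y) ∧ (∃ y ∈ G, s y ≠ y) ∧ ∀ r ∈ F, s r ≠ r
  e3 : ∃ s : L ≃ₐ[K] L, (∀ x ∈ F, s^[3] x = x) ∧ (∀ x ∈ G, s^[3] x = x) ∧
    (∃ y ∈ G, s y = y) ∧ (∃ r ∈ F, s r = r) ∧ ∃ r ∈ F, s r ≠ r
  e5 : ∃ s : L ≃ₐ[K] L, (∀ x ∈ F, s^[5] x = x) ∧ (∀ x ∈ G, s^[5] x = x) ∧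
    (∃ y ∈ G, s y = y) ∧ (∃ r ∈ F, s r = r) ∧ ∃ r ∈ F, s r ≠ r
  ed : ∃ s : L ≃ₐ[K] L, ∀ y ∈ G, s y ≠ y

theorem frobs (K L : Type) [Field K] [Field L] [Algebra ℤ[X] K] [IsFractionRing ℤ[X] K]
    [Algebra K L] [FiniteDimensional K L] [IsGalois K L]
    (hF : ((f0.map (algebraMap ℤ[X] K)).map (algebraMap K L)).Splits)
    (hG : ((g0.map (algebraMap ℤ[X] K)).map (algebraMap K L)).Splits)
    (cF : Multiset.card ((f0.map (algebraMap ℤ[X] K)).map (algebraMap K L)).roots = 11)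
    (cG : Multiset.card ((g0.map (algebraMap ℤ[X] K)).map (algebraMap K L)).roots = 12) :
    Frobs K L ((f0.map (algebraMap ℤ[X] K)).map (algebraMap K L)).roots
      ((g0.map (algebraMap ℤ[X] K)).map (algebraMap K L)).roots := by
  obtain ⟨s4, h4⟩ := frob4 ℤ[X] K L 23 (pit 4)
  obtain ⟨s3, h3⟩ := frob4 ℤ[X] K L 23 (pit 3)
  obtain ⟨s6, h6⟩ := frob4 ℤ[X] K L 23 (pit 6)
  obtain ⟨s1, h1⟩ := frob4 ℤ[X] K L 23 (pit 1)
  have F4 := h4 f0 (pit_f0 _) hF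
  have F3 := h3 f0 (pit_f0 _) hF
  have F6 := h6 f0 (pit_f0 _) hF
  have G4 := h4 g0 (pit_g0 _ (by decide +kernel)) hG
  have G3 := h3 g0 (pit_g0 _ (by decide +kernel)) hG
  have G6 := h6 g0 (pit_g0 _ (by decide +kernel)) hG
  have G1 := h1 g0 (pit_g0 _ (by decide +kernel)) hG
  refine ⟨F4.nodup 11 (by norm_num) dF4, G4.nodup 11 (by norm_num) dG4,
    ⟨s4, F4.pow 11 (by norm_num) dF4, G4.pow 11 (by norm_num) dG4,
      G4.ex 11 (by norm_num) dG4 8 ((evG _ _).trans rG4), G4.move 11 (by norm_num) dG4 ?_,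
      F4.nofix fun a => ?_⟩,
    ⟨s3, F3.pow 3 (by norm_num) dF3, G3.pow 3 (by norm_num) dG3,
      G3.ex 3 (by norm_num) dG3 6 ((evG _ _).trans rG3),
      F3.ex 3 (by norm_num) dF3 1 ((evF _ _).trans rF3), F3.move 3 (by norm_num) dF3 ?_⟩,
    ⟨s6, F6.pow 5 (by norm_num) dF6, G6.pow 5 (by norm_num) dG6,
      G6.ex 5 (by norm_num) dG6 3 ((evG _ _).trans rG6),
      F6.ex 5 (by norm_num) dF6 22 ((evF _ _).trans rF6), F6.move 5 (by norm_num) dF6 ?_⟩,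
    ⟨s1, G1.nofix fun a => ?_⟩⟩
  · simp only [evG]; rw [nG4, cG]; norm_num
  · rw [evF]; exact zF4 a
  · simp only [evF]; rw [nF3, cF]; norm_num
  · simp only [evF]; rw [nF6, cF]; norm_num
  · rw [evG]; exact zG1 a

end M11

namespace M11
open Polynomial

section
variable {R : Type} [CommRing R]
def aA (x y : R) : R := (529024662245376 + 269048605262976 * x + 55544637744288 * x ^ 2 + 5656831574328 * x ^ 3 + 269823644838 * x ^ 4 + 4421172052 * x ^ 5 + 26895517 * x ^ 6) +
  (460687340602368 + 216050346040320 * x + 39841818971328 * x ^ 2 + 3440669137488 * x ^ 3 + 121265956548 * x ^ 4 + 981239820 * x ^ 5 + 36719628 * x ^ 6) * y +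
  (-204878619095040 - 113054119123968 * x - 25777552078080 * x ^ 2 - 2956493865600 * x ^ 3 - 164036752440 * x ^ 4 - 3043424670 * x ^ 5 + 22005423 * x ^ 6) * y ^ 2 +
  (-290640510775296 - 143511214150656 * x - 28494107009280 * x ^ 2 - 2780488814400 * x ^ 3 - 126489615120 * x ^ 4 - 1987534384 * x ^ 5 - 4450864 * x ^ 6) * y ^ 3 +
  (-22329827352576 - 8665401710592 * x - 1078841617920 * x ^ 2 - 16739585280 * x ^ 3 + 5603209920 * x ^ 4 + 240666096 * x ^ 5 - 5334648 * x ^ 6) * y ^ 4 +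
  (46594751496192 + 24202451386368 * x + 5126459424768 * x ^ 2 + 549120768768 * x ^ 3 + 29165545728 * x ^ 4 + 610258176 * x ^ 5) * y ^ 5 +
  (10720327532544 + 5420946456576 * x + 1130730928128 * x ^ 2 + 119577604608 * x ^ 3 + 6300674688 * x ^ 4 + 130010144 * x ^ 5 + 323312 * x ^ 6) * y ^ 6
def aB (x y : R) : R := (-18442856272896 - 6793079686272 * x - 895659288480 * x ^ 2 - 42945098328 * x ^ 3 - 382803586 * x ^ 4 - 6119938 * x ^ 5) +
  (-21085976153088 - 8086657379328 * x - 1115224583616 * x ^ 2 - 60604348464 * x ^ 3 - 938370972 * x ^ 4 - 14670282 * x ^ 5) * y +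
  (7561929830400 + 3196356691968 * x + 513339475968 * x ^ 2 + 34421321088 * x ^ 3 + 727269048 * x ^ 4 - 5007222 * x ^ 5) * y ^ 2 +
  (12868960997376 + 5131715668992 * x + 752843089152 * x ^ 2 + 46094634432 * x ^ 3 + 879886832 * x ^ 4 + 1778216 * x ^ 5) * y ^ 3 +
  (705032626176 + 144578193408 * x - 4439204352 * x ^ 2 - 2405348352 * x ^ 3 - 112930752 * x ^ 4 + 1213872 * x ^ 5) * y ^ 4 +
  (-1949871439872 - 806457876480 * x - 125193074688 * x ^ 2 - 8513277696 * x ^ 3 - 201003264 * x ^ 4) * y ^ 5 +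
  (-411277492224 - 157467525120 * x - 22948005888 * x ^ 2 - 1467265536 * x ^ 3 - 35809664 * x ^ 4 - 73568 * x ^ 5) * y ^ 6

lemma map_aA {S : Type} [CommRing S] (φ : R →+* S) (x y : R) : φ (aA x y) = aA (φ x) (φ y) := by
  simp [aA, map_ofNat]
lemma map_aB {S : Type} [CommRing S] (φ : R →+* S) (x y : R) : φ (aB x y) = aB (φ x) (φ y) := by
  simp [aB, map_ofNat]

set_option maxHeartbeats 4000000 in
lemma ident (x y : R) : aA x y ^ 2 - (11 * x ^ 2 + 143 * x + 621) * aB x y ^ 2 =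
    -5 * (x + 4) * (pG y * qF x - qG y * pF x) := by
  simp only [aA, aB, pG, qF, qG, pF]
  ring
end

lemma bz1 {L : Type} [Field L] [CharZero L] (x : L) (h1 : 77 * x ^ 3 + 10989 * x ^ 2 + 129816 * x + 496368 = 0)
    (h2 : 11 * x ^ 2 - 1296 = 0) : False := by
  have : (47628000000 : L) = 0 := by linear_combination (91212 - 7073 * x) * h1 + (-1815804 + 6427443 * x + 49511 * x ^ 2) * h2
  norm_num at this

lemma bz2 {L : Type} [Field L] [CharZero L] (x : L) (h1 : 77 * x ^ 3 + 10989 * x ^ 2 + 129816 * x + 496368 = 0)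
    (h2 : 11 * x ^ 2 + 143 * x + 621 = 0) : False := by
  have : (31640625 : L) = 0 := by linear_combination (-187 + 77 * x) * h1 + (200421 - 68607 * x - 539 * x ^ 2) * h2
  norm_num at this

lemma bz3 {L : Type} [Field L] [CharZero L] (x : L) (h1 : 77 * x ^ 2 + 2376 * x + 15472 = 0)
    (h2 : 11 * x ^ 2 - 1296 = 0) : False := by
  have : (7840000 : L) = 0 := by linear_combination (-3068 + 297 * x) * h1 + (-42676 - 2079 * x) * h2
  norm_num at this

lemma bz4 {L : Type} [Field L] [CharZero L] (x : L) (h1 : 77 * x ^ 2 + 2376 * x + 15472 = 0)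
    (h2 : 11 * x ^ 2 + 143 * x + 621 = 0) : False := by
  have : (253125 : L) = 0 := by linear_combination (-54 - 11 * x) * h1 + (1753 + 77 * x) * h2
  norm_num at this

end M11

namespace M11
open Polynomial Finset
open scoped Classical

section
variable {L : Type} [Field L] (Y : Type) [Fintype Y] (v : Y → L)

structure Six (α β : L → L) : Prop where
  trans : ∀ x y z, α (v x) * β (v y) = α (v y) * β (v x) → α (v y) * β (v z) = α (v z) * β (v y) →
    α (v x) * β (v z) = α (v z) * β (v x)
  two : ∀ x y z, ¬ α (v x) * β (v y) = α (v y) * β (v x) → ¬ α (v y) * β (v z) = α (v z) * β (v y) →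
    α (v x) * β (v z) = α (v z) * β (v x)
  six : ∀ y, #{z | α (v y) * β (v z) = α (v z) * β (v y)} = 6

lemma card_le_six (hv : Function.Injective v) (p : L[X]) (hp : p ≠ 0) (hd : p.natDegree ≤ 6)
    (S : Finset Y) (hS : ∀ z ∈ S, p.eval (v z) = 0) : #S ≤ 6 := by
  have h1 : #(S.image v) = #S := card_image_of_injective _ hv
  have h2 : S.image v ⊆ p.roots.toFinset := by
    intro a ha
    obtain ⟨z, hz, rfl⟩ := mem_image.1 ha
    rw [Multiset.mem_toFinset, mem_roots hp]
    exact hS z hz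
  have h3 := card_le_card h2
  have h4 := Multiset.toFinset_card_le p.roots
  have h5 := card_roots' p
  omega

theorem six_of (hv : Function.Injective v) (hY : Fintype.card Y = 12) (α β H : L[X]) (D c : L)
    (hα : α.natDegree ≤ 6) (hβ : β.natDegree ≤ 6) (hc : c ≠ 0) (hH : H ≠ 0) (hn : H.roots.Nodup)
    (hr : ∀ y, H.eval (v y) = 0) (hid : α ^ 2 - C D * β ^ 2 = C c * H) :
    Six Y v (fun y => α.eval y) (fun y => β.eval y) := by
  have hsq : ∀ y, α.eval (v y) ^ 2 = D * β.eval (v y) ^ 2 := by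
    intro y
    have := congrArg (eval (v y)) hid
    simp [hr y] at this
    linear_combination this
  have hb : ∀ y, β.eval (v y) ≠ 0 := by
    intro y hy
    have ha : α.eval (v y) = 0 := by
      have := hsq y; rw [hy] at this; simpa using this
    have d1 := dvd_iff_isRoot.2 hy
    have d2 := dvd_iff_isRoot.2 ha
    have d3 : (X - C (v y)) ^ 2 ∣ C c * H := by
      rw [← hid]
      exact dvd_sub (pow_dvd_pow_of_dvd d2 2) (Dvd.dvd.mul_left (pow_dvd_pow_of_dvd d1 2) _)
    have d4 : (X - C (v y)) ^ 2 ∣ H := by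
      have := Dvd.dvd.mul_left d3 (C c⁻¹)
      rwa [← mul_assoc, ← C_mul, inv_mul_cancel₀ hc, C_1, one_mul] at this
    have d5 := (le_rootMultiplicity_iff hH).2 d4
    have d6 := Multiset.nodup_iff_count_le_one.1 hn (v y)
    rw [count_roots] at d6
    omega
  set ρ : Y → L := fun y => α.eval (v y) / β.eval (v y) with hρ
  have hE : ∀ y z, α.eval (v y) * β.eval (v z) = α.eval (v z) * β.eval (v y) ↔ ρ y = ρ z := by
    intro y z
    rw [hρ]; simp only
    rw [div_eq_div_iff (hb y) (hb z)]
  have hρ2 : ∀ y, ρ y ^ 2 = D := by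
    intro y
    rw [hρ]; simp only
    rw [div_pow, hsq y, mul_div_assoc, div_self (pow_ne_zero 2 (hb y)), mul_one]
  have hneg : ∀ y z, ρ y ≠ ρ z → ρ y = - ρ z := by
    intro y z h
    have : (ρ y - ρ z) * (ρ y + ρ z) = 0 := by linear_combination hρ2 y - hρ2 z
    rcases mul_eq_zero.1 this with h1 | h1
    · exact absurd (sub_eq_zero.1 h1) h
    · exact eq_neg_of_add_eq_zero_left h1
  refine ⟨?_, ?_, ?_⟩
  · intro x y z; simp only [hE]; exact Eq.trans
  · intro x y z; simp only [hE]; intro h1 h2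
    rw [hneg _ _ h1, hneg _ _ h2, neg_neg]
  · intro y
    simp only [hE]
    have hprod : (α - C (ρ y) * β) * (α + C (ρ y) * β) = C c * H := by
      rw [← hid, ← hρ2 y, C_pow]; ring
    have hne : C c * H ≠ 0 := mul_ne_zero (C_ne_zero.2 hc) hH
    rw [← hprod] at hne
    have hdeg : (C (ρ y) * β).natDegree ≤ 6 := (natDegree_C_mul_le _ _).trans hβ
    have hval : ∀ z, α.eval (v z) = ρ z * β.eval (v z) := fun z => (div_mul_cancel₀ _ (hb z)).symm
    have c1 : #{z | ρ y = ρ z} ≤ 6 := by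
      refine card_le_six Y v hv _ (left_ne_zero_of_mul hne) ((natDegree_sub_le _ _).trans (by simp [hα, hdeg])) _ ?_
      intro z hz
      rw [mem_filter] at hz
      simp [hval z, hz.2]
    have c2 : #{z | ¬ ρ y = ρ z} ≤ 6 := by
      refine card_le_six Y v hv _ (right_ne_zero_of_mul hne) ((natDegree_add_le _ _).trans (by simp [hα, hdeg])) _ ?_
      intro z hz
      rw [mem_filter] at hz
      have := hneg _ _ hz.2
      simp [hval z, this]
    have c3 := card_filter_add_card_filter_not (s := (univ : Finset Y)) (fun z => ρ y = ρ z)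
    rw [card_univ, hY] at c3
    omega
end

lemma eval_aA {L : Type} [CommRing L] (x y : L) : (aA (C x) X : L[X]).eval y = aA x y := by
  have := map_aA (evalRingHom y) (C x) X
  simpa using this
lemma eval_aB {L : Type} [CommRing L] (x y : L) : (aB (C x) X : L[X]).eval y = aB x y := by
  have := map_aB (evalRingHom y) (C x) X
  simpa using this

lemma deg_sum {L : Type} [CommRing L] (c0 c1 c2 c3 c4 c5 c6 : L) :
    (C c0 + C c1 * X + C c2 * X ^ 2 + C c3 * X ^ 3 + C c4 * X ^ 4 + C c5 * X ^ 5 + C c6 * X ^ 6 : L[X]).natDegree ≤ 6 := by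
  compute_degree

lemma deg_aA {L : Type} [CommRing L] (x : L) : (aA (C x) X : L[X]).natDegree ≤ 6 := by
  unfold aA
  simp only [← C_pow, ← C_ofNat, ← C_mul, ← C_add, ← C_sub, ← C_neg]
  exact deg_sum _ _ _ _ _ _ _
lemma deg_aB {L : Type} [CommRing L] (x : L) : (aB (C x) X : L[X]).natDegree ≤ 6 := by
  unfold aB
  simp only [← C_pow, ← C_ofNat, ← C_mul, ← C_add, ← C_sub, ← C_neg]
  exact deg_sum _ _ _ _ _ _ _

theorem six_main {L : Type} [Field L] [CharZero L] (Y : Type) [Fintype Y] (v : Y → L)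
    (hv : Function.Injective v) (hY : Fintype.card Y = 12) (τ : L)
    (hH : (pG X - C τ * qG X : L[X]) ≠ 0) (hn : (pG X - C τ * qG X : L[X]).roots.Nodup)
    (hr : ∀ y, pG (v y) - τ * qG (v y) = 0) (hτ : pF (-4) - τ * qF (-4) ≠ 0)
    (x : L) (hx : pF x - τ * qF x = 0) : Six Y v (aA x) (aB x) := by
  have hq : qF x ≠ 0 := by
    intro h
    have hp : pF x = 0 := by rw [h] at hx; simpa using hx
    unfold qF at h; unfold pF at hp
    rcases mul_eq_zero.1 h with h | h <;> rcases mul_eq_zero.1 hp with hp | hp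
    · exact bz1 x (pow_eq_zero_iff (by norm_num) |>.1 hp) (pow_eq_zero_iff (by norm_num) |>.1 h)
    · exact bz3 x hp (pow_eq_zero_iff (by norm_num) |>.1 h)
    · exact bz2 x (pow_eq_zero_iff (by norm_num) |>.1 hp) h
    · exact bz4 x hp h
  have h4 : x + 4 ≠ 0 := by
    intro h
    rw [eq_neg_of_add_eq_zero_left h] at hx
    exact hτ hx
  have hc : -5 * (x + 4) * qF x ≠ 0 := mul_ne_zero (mul_ne_zero (by norm_num) h4) hq
  have := six_of Y v hv hY (aA (C x) X) (aB (C x) X) _ (11 * x ^ 2 + 143 * x + 621) _ (deg_aA x) (deg_aB x)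
    hc hH hn (fun y => by rw [eval_G]; exact hr y) (by
      have e := ident (C x : L[X]) X
      have e1 : pF (C x : L[X]) = C (pF x) := (map_pF C x).symm
      have e2 : qF (C x : L[X]) = C (qF x) := (map_qF C x).symm
      have e3 : C (pF x) = C τ * C (qF x) := by rw [← C_mul, sub_eq_zero.1 hx]
      rw [e1, e2, e3] at e
      simp only [C_mul, C_add, C_neg, C_pow, C_ofNat]
      rw [e]; ring)
  simpa only [eval_aA, eval_aB] using this

end M11

namespace M11
open Polynomial Finset
open scoped Classical

lemma iter_eq {K L : Type} [Field K] [Field L] [Algebra K L] (s : L ≃ₐ[K] L) (n : ℕ) (x : L) :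
    (s ^ n) x = s^[n] x := by
  induction n generalizing x with
  | zero => rfl
  | succ n ih => rw [pow_succ, Function.iterate_succ_apply, ← ih]; rfl

theorem main_conf (K L : Type) [Field K] [Field L] [Algebra ℤ[X] K] [IsFractionRing ℤ[X] K]
    [Algebra K L] [FiniteDimensional K L] [IsGalois K L] [CharZero L] (F H : Multiset L) (τ : L)
    (fr : Frobs K L F H) (hτ' : ∀ σ : L ≃ₐ[K] L, σ τ = τ)
    (hτ : pF (-4) - τ * qF (-4) ≠ 0)
    (hF : ∀ x, x ∈ F ↔ pF x - τ * qF x = 0)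
    (hH : H = (pG X - C τ * qG X : L[X]).roots)
    (cF : Multiset.card F = 11) (cH : Multiset.card H = 12)
    (hadj : ∀ σ : L ≃ₐ[K] L, (∀ x ∈ F, σ x = x) → (∀ y ∈ H, σ y = y) → σ = 1) :
    Nat.card (L ≃ₐ[K] L) = 7920 ∧ IsSimpleGroup (L ≃ₐ[K] L) ∧
      ∀ σ : L ≃ₐ[K] L, (∀ x ∈ F, σ x = x) → σ = 1 := by
  have hH0 : (pG X - C τ * qG X : L[X]) ≠ 0 := by
    intro h; rw [h] at hH; rw [hH] at cH; simp at cH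
  have hHm : ∀ y, y ∈ H ↔ pG y - τ * qG y = 0 := by
    intro y; rw [hH, mem_roots hH0, IsRoot, eval_G]
  have sF : ∀ (σ : L ≃ₐ[K] L) x, x ∈ F.toFinset → σ x ∈ F.toFinset := by
    intro σ x
    rw [Multiset.mem_toFinset, Multiset.mem_toFinset, hF, hF]
    intro h
    have := congrArg (σ : L →+* L) h
    rw [map_sub, map_mul, map_pF, map_qF, map_zero] at this
    simpa [hτ'] using this
  have sH : ∀ (σ : L ≃ₐ[K] L) x, x ∈ H.toFinset → σ x ∈ H.toFinset := by
    intro σ x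
    rw [Multiset.mem_toFinset, Multiset.mem_toFinset, hHm, hHm]
    intro h
    have := congrArg (σ : L →+* L) h
    rw [map_sub, map_mul, map_pG, map_qG, map_zero] at this
    simpa [hτ'] using this
  letI aF : MulAction (L ≃ₐ[K] L) {x // x ∈ F.toFinset} :=
    { smul := fun σ x => ⟨σ x.1, sF σ x.1 x.2⟩
      one_smul := fun x => rfl
      mul_smul := fun a b x => rfl }
  letI aH : MulAction (L ≃ₐ[K] L) {x // x ∈ H.toFinset} :=
    { smul := fun σ x => ⟨σ x.1, sH σ x.1 x.2⟩
      one_smul := fun x => rfl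
      mul_smul := fun a b x => rfl }
  have vF : ∀ (σ : L ≃ₐ[K] L) (x : {x // x ∈ F.toFinset}), (σ • x).1 = σ x.1 := fun _ _ => rfl
  have vH : ∀ (σ : L ≃ₐ[K] L) (x : {x // x ∈ H.toFinset}), (σ • x).1 = σ x.1 := fun _ _ => rfl
  have cF' : Fintype.card {x // x ∈ F.toFinset} = 11 := by
    rw [Fintype.card_coe, Multiset.toFinset_card_of_nodup fr.nF, cF]
  have cH' : Fintype.card {x // x ∈ H.toFinset} = 12 := by
    rw [Fintype.card_coe, Multiset.toFinset_card_of_nodup fr.nG, cH]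
  have six : ∀ r : {x // x ∈ F.toFinset},
      Six {x // x ∈ H.toFinset} (fun y => y.1) (aA r.1) (aB r.1) := by
    intro r
    refine six_main _ _ Subtype.val_injective cH' τ hH0 (hH ▸ fr.nG) ?_ hτ r.1 ?_
    · intro y; exact (hHm _).1 (Multiset.mem_toFinset.1 y.2)
    · exact (hF _).1 (Multiset.mem_toFinset.1 r.2)
  have hpow : ∀ (s : L ≃ₐ[K] L) n, (∀ x ∈ F, s^[n] x = x) → (∀ x ∈ H, s^[n] x = x) → s ^ n = 1 := by
    intro s n h1 h2
    refine hadj _ (fun x hx => ?_) (fun x hx => ?_) <;> rw [iter_eq]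
    · exact h1 x hx
    · exact h2 x hx
  have exF : ∀ s : L ≃ₐ[K] L, (∃ r ∈ F, s r = r) → ∃ r : {x // x ∈ F.toFinset}, s • r = r :=
    fun s ⟨r, h, e⟩ => ⟨⟨r, Multiset.mem_toFinset.2 h⟩, Subtype.ext e⟩
  have exH : ∀ s : L ≃ₐ[K] L, (∃ r ∈ H, s r = r) → ∃ r : {x // x ∈ H.toFinset}, s • r = r :=
    fun s ⟨r, h, e⟩ => ⟨⟨r, Multiset.mem_toFinset.2 h⟩, Subtype.ext e⟩
  have conf : Conf (L ≃ₐ[K] L) {x // x ∈ F.toFinset} {x // x ∈ H.toFinset}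
      (fun r y z => aA r.1 y.1 * aB r.1 z.1 = aA r.1 z.1 * aB r.1 y.1) := by
    refine ⟨cF', cH', ?_, ?_, ?_, ?_, ?_, ?_, ?_, ?_, ?_, ?_, ?_⟩
    · intro σ h1 h2
      refine hadj σ (fun x hx => ?_) (fun x hx => ?_)
      · exact congrArg Subtype.val (h1 ⟨x, Multiset.mem_toFinset.2 hx⟩)
      · exact congrArg Subtype.val (h2 ⟨x, Multiset.mem_toFinset.2 hx⟩)
    · intro r y; rfl
    · intro r y z h; exact h.symm
    · intro r; exact (six r).trans
    · intro r; exact (six r).two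
    · intro r y; exact (six r).six y
    · intro σ r y z h
      have := congrArg (σ : L →+* L) h
      rw [map_mul, map_mul, map_aA, map_aB, map_aA, map_aB] at this
      exact this
    · obtain ⟨s, h1, h2, h3, ⟨y, hy, hy'⟩, h5⟩ := fr.e11
      refine ⟨s, hpow s _ h1 h2, exH s h3, ⟨⟨y, Multiset.mem_toFinset.2 hy⟩, ?_⟩, ?_⟩
      · intro e; exact hy' (congrArg Subtype.val e)
      · intro r e; exact h5 r.1 (Multiset.mem_toFinset.1 r.2) (congrArg Subtype.val e)
    · obtain ⟨s, h1, h2, h3, h4, ⟨y, hy, hy'⟩⟩ := fr.e3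
      refine ⟨s, hpow s _ h1 h2, ?_, exH s h3, exF s h4⟩
      rintro rfl; exact hy' rfl
    · obtain ⟨s, h1, h2, h3, h4, ⟨y, hy, hy'⟩⟩ := fr.e5
      refine ⟨s, hpow s _ h1 h2, ?_, exH s h3, exF s h4⟩
      rintro rfl; exact hy' rfl
    · obtain ⟨s, h⟩ := fr.ed
      exact ⟨s, fun r e => h r.1 (Multiset.mem_toFinset.1 r.2) (congrArg Subtype.val e)⟩
  refine ⟨conf.card, conf.simple, fun σ h => conf.faithR σ fun r => Subtype.ext ?_⟩
  exact h r.1 (Multiset.mem_toFinset.1 r.2)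

end M11

namespace M11

noncomputable def phi : ℤ[X] →+* RatFunc ℚ :=
  (algebraMap ℚ[X] (RatFunc ℚ)).comp (mapRingHom (Int.castRingHom ℚ))

lemma phi_inj : Function.Injective phi :=
  (IsFractionRing.injective ℚ[X] (RatFunc ℚ)).comp
    (map_injective _ (RingHom.injective_int _))

lemma phi_X : phi X = t := by simp [phi, t]

lemma phi_num (q : ℚ[X]) : ∃ (b : ℤ) (P : ℤ[X]), b ≠ 0 ∧
    phi P = phi (C b) * algebraMap ℚ[X] (RatFunc ℚ) q := by
  obtain ⟨b, hb, h⟩ := IsLocalization.integerNormalization_spec (nonZeroDivisors ℤ) q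
  refine ⟨b, IsLocalization.integerNormalization (nonZeroDivisors ℤ) q,
    nonZeroDivisors.ne_zero hb, ?_⟩
  · have h' : map (Int.castRingHom ℚ) (IsLocalization.integerNormalization (nonZeroDivisors ℤ) q)
      = b • q := h
    simp only [phi, RingHom.comp_apply, coe_mapRingHom, h', map_C]
    rw [← map_mul]
    congr 1
    simp [zsmul_eq_mul]

@[reducible] noncomputable def algZ : Algebra ℤ[X] (RatFunc ℚ) := phi.toAlgebra

attribute [local instance] algZ

lemma algZ_map : algebraMap ℤ[X] (RatFunc ℚ) = phi := rfl

instance fracZ : IsFractionRing ℤ[X] (RatFunc ℚ) := by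
  have : FaithfulSMul ℤ[X] (RatFunc ℚ) := (faithfulSMul_iff_algebraMap_injective _ _).2 phi_inj
  refine IsFractionRing.of_field _ _ fun z => ?_
  obtain ⟨a, P, ha, hP⟩ := phi_num z.num
  obtain ⟨b, Q, hb, hQ⟩ := phi_num z.denom
  refine ⟨C b * P, C a * Q, ?_⟩
  rw [algZ_map, map_mul, map_mul, hP, hQ]
  have h1 : phi (C a) ≠ 0 := by rw [map_ne_zero_iff _ phi_inj]; exact C_ne_zero.2 ha
  have h2 : phi (C b) ≠ 0 := by rw [map_ne_zero_iff _ phi_inj]; exact C_ne_zero.2 hb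
  have h3 : algebraMap ℚ[X] (RatFunc ℚ) z.denom ≠ 0 := by
    rw [map_ne_zero_iff _ (IsFractionRing.injective ℚ[X] (RatFunc ℚ))]; exact z.denom_ne_zero
  conv_lhs => rw [← RatFunc.num_div_denom z]
  field_simp

lemma f_eq : f = f0.map (algebraMap ℤ[X] (RatFunc ℚ)) := by
  rw [map_f0, algZ_map, phi_X]; rfl

lemma f_deg : f.natDegree = 11 := by
  have e : f = pF X - C t * qF X := rfl
  rw [e]
  refine natDegree_eq_of_le_of_coeff_ne_zero (degF _) ?_
  rw [coeffF]; norm_num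

noncomputable def gK : (RatFunc ℚ)[X] := g0.map (algebraMap ℤ[X] (RatFunc ℚ))

lemma gK_deg : gK.natDegree = 12 := by
  have h : g0.natDegree = 12 := natDegree_eq_of_le_of_coeff_ne_zero (degG _) (by
    have := coeffG (X : ℤ[X]); rw [g0, this]; exact g0_lc_ne)
  rw [gK, algZ_map, natDegree_map_eq_of_injective phi_inj, h]

lemma mapF {L : Type} [Field L] [Algebra (RatFunc ℚ) L] :
    f.map (algebraMap (RatFunc ℚ) L) = pF X - C (algebraMap (RatFunc ℚ) L t) * qF X := by
  rw [f_eq, Polynomial.map_map, map_f0, RingHom.comp_apply, algZ_map, phi_X]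

lemma mapG {L : Type} [Field L] [Algebra (RatFunc ℚ) L] :
    gK.map (algebraMap (RatFunc ℚ) L) = pG X - C (algebraMap (RatFunc ℚ) L t) * qG X := by
  rw [gK, Polynomial.map_map, map_g0, RingHom.comp_apply, algZ_map, phi_X]

lemma tau_ne {L : Type} [Field L] [Algebra (RatFunc ℚ) L] :
    pF (-4) - algebraMap (RatFunc ℚ) L t * qF (-4) ≠ 0 := by
  have h : (pF (-4) - X * qF (-4) : ℤ[X]) ≠ 0 := by
    intro h
    have := congrArg (eval 0) h
    norm_num [pF] at this
  have hi : Function.Injective ((algebraMap (RatFunc ℚ) L).comp phi) :=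
    (algebraMap (RatFunc ℚ) L).injective.comp phi_inj
  have h2 := (map_ne_zero_iff _ hi).2 h
  rw [map_sub, map_mul, map_pF, map_qF, map_neg, map_ofNat] at h2
  rw [RingHom.comp_apply, phi_X] at h2
  exact h2

theorem final : IsSimpleGroup f.Gal ∧ Nat.card f.Gal = 7920 := by
  classical
  have hf0 : f ≠ 0 := by intro h; have := f_deg; rw [h] at this; simp at this
  have hg0 : gK ≠ 0 := by intro h; have := gK_deg; rw [h] at this; simp at this
  have h0 : f * gK ≠ 0 := mul_ne_zero hf0 hg0
  set K := RatFunc ℚ with hK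
  set L := (f * gK).SplittingField with hL
  have sp : ((f * gK).map (algebraMap K L)).Splits := SplittingField.splits _
  have spf : (f.map (algebraMap K L)).Splits :=
    sp.of_dvd (Polynomial.map_ne_zero h0) (Polynomial.map_dvd _ (dvd_mul_right _ _))
  have spg : (gK.map (algebraMap K L)).Splits :=
    sp.of_dvd (Polynomial.map_ne_zero h0) (Polynomial.map_dvd _ (dvd_mul_left _ _))
  have : CharZero L := charZero_of_injective_algebraMap (algebraMap K L).injective
  have : IsGalois K L := { to_isSeparable := inferInstance, to_normal := Normal.of_isSplittingField (f * gK) }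
  have cF : Multiset.card (f.map (algebraMap K L)).roots = 11 := by
    rw [← spf.natDegree_eq_card_roots, natDegree_map, f_deg]
  have cG : Multiset.card (gK.map (algebraMap K L)).roots = 12 := by
    rw [← spg.natDegree_eq_card_roots, natDegree_map, gK_deg]
  have fr := frobs K L (by rw [← f_eq]; exact spf) spg (by rw [← f_eq]; exact cF) cG
  rw [← f_eq] at fr
  have hadj : ∀ σ : L ≃ₐ[K] L, (∀ x ∈ (f.map (algebraMap K L)).roots, σ x = x) →
      (∀ y ∈ (gK.map (algebraMap K L)).roots, σ y = y) → σ = 1 := by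
    intro σ h1 h2
    refine Gal.ext (f * gK) fun x hx => ?_
    rw [rootSet_def, aroots_mul h0] at hx
    rcases Multiset.mem_add.mp (Multiset.mem_toFinset.mp hx) with h | h
    · exact h1 x h
    · exact h2 x h
  obtain ⟨m1, m2, m3⟩ := main_conf K L _ _ (algebraMap K L t) fr (fun σ => σ.commutes _) tau_ne
    (fun x => by
      rw [mem_roots (Polynomial.map_ne_zero hf0), IsRoot, mapF, eval_F])
    (by rw [← mapG]; rfl) cF cG hadj
  have : Fact (f.map (algebraMap K L)).Splits := ⟨spf⟩
  have hb : Function.Bijective (Gal.restrict f L) := by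
    refine ⟨?_, Gal.restrict_surjective f L⟩
    rw [injective_iff_map_eq_one]
    intro σ hσ
    refine m3 σ fun x hx => ?_
    have hx' : x ∈ f.rootSet L := by
      rw [rootSet_def]; exact Multiset.mem_toFinset.2 hx
    have := Gal.restrict_smul σ ⟨x, hx'⟩
    rw [hσ, one_smul] at this
    exact this.symm
  let e := MulEquiv.ofBijective _ hb
  exact ⟨(MulEquiv.isSimpleGroup_congr e).1 m2, by rw [← Nat.card_congr e.toEquiv]; exact m1⟩

end M11

theorem m11_2234 : f.natDegree = 11 ∧ IsSimpleGroup f.Gal ∧ Nat.card f.Gal = 7920 :=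
  ⟨M11.f_deg, M11.final.1, M11.final.2⟩
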